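/- arXiv:1606.05311 — 8 statements merged into one kernel-verified Lean document; each statement's English description precedes it below -/
import Mathlib

section
/- Let f : ℝ → ℝ be a continuous fixed-point free bijection (f(x) ≠ x for all x). Then there exists a binary operation +_f on ℝ such that (ℝ, +_f) equipped with the Euclidean topology is a topological group, there exists a map φ : ℝ → ℝ that is simultaneously a group isomorphism from (ℝ, +) to (ℝ, +_f) and a homeomorphism of the Euclidean topology, and there exists an element c ∈ ℝ, not the neutral element of +_f, such that f(x) = x +_f c for all x ∈ ℝ. -/
/-- The orbit of a point under an order automorphism moving every point up has no upper bound. -/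
theorem OrderIso.exists_lt_zpow_apply (F : ℝ ≃o ℝ) (hF : ∀ x, x < F x) (a y : ℝ) :
    ∃ n : ℤ, y < (F ^ n) a := by
  by_contra! h
  have hb : BddAbove (Set.range fun n : ℤ => (F ^ n) a) := ⟨y, by rintro _ ⟨n, rfl⟩; exact h n⟩
  have hs := isLUB_ciSup hb
  set s := ⨆ n : ℤ, (F ^ n) a
  have hlt : F.symm s < s := by simpa using hF (F.symm s)
  obtain ⟨_, ⟨n, rfl⟩, hn, -⟩ := hs.exists_between hlt
  have hle : (F ^ (1 + n)) a ≤ s := hs.1 ⟨1 + n, rfl⟩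
  rw [zpow_one_add, RelIso.mul_apply] at hle
  exact (F.symm_apply_lt.1 hn).not_ge hle

/-- The orbit of a point under an order automorphism moving every point up has no lower bound. -/
theorem OrderIso.exists_zpow_apply_lt (F : ℝ ≃o ℝ) (hF : ∀ x, x < F x) (a y : ℝ) :
    ∃ n : ℤ, (F ^ n) a < y := by
  obtain ⟨n, hn⟩ := F.exists_lt_zpow_apply hF y a
  refine ⟨-n, ?_⟩
  have h := (F ^ (-n)).strictMono hn
  rwa [← RelIso.mul_apply, ← zpow_add, neg_add_cancel, zpow_zero] at h

/-- The orbit of a point under an order automorphism moving every point up is increasing. -/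
theorem OrderIso.strictMono_zpow_apply (F : ℝ ≃o ℝ) (hF : ∀ x, x < F x) (a : ℝ) :
    StrictMono fun n : ℤ => (F ^ n) a := by
  refine strictMono_int_of_lt_succ fun n => ?_
  rw [add_comm, zpow_one_add, RelIso.mul_apply]
  exact hF _

/-- An order automorphism of `ℝ` moving every point up is conjugate to the translation by `1`. -/
theorem OrderIso.exists_conj_add_one (F : ℝ ≃o ℝ) (hF : ∀ x, x < F x) :
    ∃ φ : ℝ ≃o ℝ, ∀ x, φ (x + 1) = F (φ x) := by
  have hc : 0 < F 0 := hF 0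
  have hmono : StrictMono fun x : ℝ => (F ^ ⌊x⌋) (Int.fract x * F 0) := by
    intro x y hxy
    change (F ^ ⌊x⌋) (Int.fract x * F 0) < (F ^ ⌊y⌋) (Int.fract y * F 0)
    rcases (Int.floor_mono hxy.le).eq_or_lt with h | h
    · rw [h]
      refine (F ^ ⌊y⌋).strictMono (mul_lt_mul_of_pos_right ?_ hc)
      rw [Int.fract, Int.fract, h]
      linarith
    · calc (F ^ ⌊x⌋) (Int.fract x * F 0) < (F ^ ⌊x⌋) (F 0) :=
            (F ^ ⌊x⌋).strictMono (mul_lt_of_lt_one_left hc (Int.fract_lt_one x))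
        _ = (F ^ (⌊x⌋ + 1)) 0 := by rw [zpow_add_one, RelIso.mul_apply]
        _ ≤ (F ^ ⌊y⌋) 0 := (F.strictMono_zpow_apply hF 0).monotone h
        _ ≤ (F ^ ⌊y⌋) (Int.fract y * F 0) :=
            (F ^ ⌊y⌋).monotone (mul_nonneg (Int.fract_nonneg y) hc.le)
  have hsurj : Function.Surjective fun x : ℝ => (F ^ ⌊x⌋) (Int.fract x * F 0) := by
    intro y
    obtain ⟨m, hm⟩ := F.exists_lt_zpow_apply hF 0 y
    obtain ⟨k, hk⟩ := F.exists_zpow_apply_lt hF 0 y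
    obtain ⟨n, hn, hmax⟩ := Int.exists_greatest_of_bdd (P := fun n => (F ^ n) 0 ≤ y)
      ⟨m, fun z hz => (F.strictMono_zpow_apply hF 0).le_iff_le.1 (hz.trans hm.le)⟩ ⟨k, hk.le⟩
    have hn' : y < (F ^ (n + 1)) 0 := by
      by_contra! h
      have := hmax _ h
      omega
    rw [zpow_add_one, RelIso.mul_apply] at hn'
    obtain ⟨t, rfl⟩ := (F ^ n).surjective y
    have ht0 : 0 ≤ t := (F ^ n).le_iff_le.1 hn
    have ht1 : t < F 0 := (F ^ n).lt_iff_lt.1 hn'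
    have h0 : 0 ≤ t / F 0 := div_nonneg ht0 hc.le
    have h1 : t / F 0 < 1 := (div_lt_one hc).2 ht1
    refine ⟨n + t / F 0, ?_⟩
    change (F ^ ⌊(n : ℝ) + t / F 0⌋) (Int.fract ((n : ℝ) + t / F 0) * F 0) = _
    rw [Int.floor_intCast_add, Int.fract_intCast_add, Int.floor_eq_zero_iff.2 ⟨h0, h1⟩,
      Int.fract_eq_self.2 ⟨h0, h1⟩, add_zero, div_mul_cancel₀ _ hc.ne']
  refine ⟨hmono.orderIsoOfSurjective _ hsurj, fun x => ?_⟩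
  change (F ^ ⌊x + 1⌋) (Int.fract (x + 1) * F 0) = F ((F ^ ⌊x⌋) (Int.fract x * F 0))
  rw [Int.floor_add_one, Int.fract_add_one, add_comm, zpow_one_add, RelIso.mul_apply]

/-- A continuous fixed-point free map moves all points in the same direction. -/
theorem Continuous.forall_lt_or_forall_gt_of_ne {f : ℝ → ℝ} (hf : Continuous f)
    (h : ∀ x, f x ≠ x) : (∀ x, x < f x) ∨ ∀ x, f x < x := by
  by_contra! hne
  obtain ⟨⟨a, ha⟩, b, hb⟩ := hne
  obtain ⟨x, hx⟩ := mem_range_of_exists_le_of_exists_ge (c := 0) (hf.sub continuous_id)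
    ⟨a, sub_nonpos.2 ha⟩ ⟨b, sub_nonneg.2 hb⟩
  exact h x (sub_eq_zero.1 hx)

/-- A continuous fixed-point free bijection of `ℝ` is strictly increasing. -/
theorem Continuous.strictMono_of_bijective_of_ne {f : ℝ → ℝ} (hf : Continuous f)
    (hbij : Function.Bijective f) (h : ∀ x, f x ≠ x) : StrictMono f := by
  refine (hf.strictMono_of_inj hbij.1).resolve_right fun hanti => ?_
  rcases hf.forall_lt_or_forall_gt_of_ne h with hlt | hlt
  · exact (hanti (hlt 0)).not_gt (hlt _)
  · exact (hanti (hlt 0)).not_gt (hlt _)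

/-- A continuous fixed-point free bijection of `ℝ` is conjugate to a nonzero translation. -/
theorem Continuous.exists_conj_translation {f : ℝ → ℝ} (hf : Continuous f)
    (hbij : Function.Bijective f) (h : ∀ x, f x ≠ x) :
    ∃ (φ : ℝ ≃ₜ ℝ) (d : ℝ), d ≠ 0 ∧ ∀ x, f (φ x) = φ (x + d) := by
  let F : ℝ ≃o ℝ := (hf.strictMono_of_bijective_of_ne hbij h).orderIsoOfSurjective f hbij.2
  have hF : ∀ x, F x = f x := fun _ => rfl
  rcases hf.forall_lt_or_forall_gt_of_ne h with hlt | hlt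
  · obtain ⟨φ, hφ⟩ := F.exists_conj_add_one hlt
    exact ⟨φ.toHomeomorph, 1, one_ne_zero, fun x => (hφ x).symm⟩
  · obtain ⟨φ, hφ⟩ := F.symm.exists_conj_add_one fun x => F.lt_symm_apply.2 (hlt x)
    refine ⟨φ.toHomeomorph, -1, by norm_num, fun x => ?_⟩
    have hx := hφ (x + -1)
    rw [neg_add_cancel_right] at hx
    change F (φ x) = φ (x + -1)
    rw [hx, F.apply_symm_apply]


/-- Any continuous fixed-point free bijection on ℝ is a shift with respect to
some group operation on ℝ making it a topological group topologically isomorphic to (ℝ, +). -/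
theorem stmt_0 (f : ℝ → ℝ) (hcont : Continuous f) (hbij : Function.Bijective f)
    (hfpf : ∀ x : ℝ, f x ≠ x) :
    ∃ (op : ℝ → ℝ → ℝ) (e : ℝ) (inv : ℝ → ℝ),
      (∀ a b c : ℝ, op (op a b) c = op a (op b c)) ∧
      (∀ a : ℝ, op e a = a) ∧ (∀ a : ℝ, op a e = a) ∧
      (∀ a : ℝ, op (inv a) a = e) ∧
      Continuous (fun p : ℝ × ℝ => op p.1 p.2) ∧
      Continuous inv ∧
      (∃ φ : ℝ ≃ₜ ℝ, ∀ x y : ℝ, φ (x + y) = op (φ x) (φ y)) ∧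
      (∃ c : ℝ, c ≠ e ∧ ∀ x : ℝ, f x = op x c) := by
  obtain ⟨φ, d, hd, hφ⟩ := hcont.exists_conj_translation hbij hfpf
  refine ⟨fun a b => φ (φ.symm a + φ.symm b), φ 0, fun a => φ (-φ.symm a), ?_, ?_, ?_, ?_, ?_, ?_,
    ⟨φ, ?_⟩, φ d, ?_, ?_⟩
  · simp [add_assoc]
  · simp
  · simp
  · simp
  · fun_prop
  · fun_prop
  · simp
  · simpa using hd
  · intro x
    simpa using hφ (φ.symm x)
end

section
/- Let G be an additive subgroup of ℝ, equipped with the subspace (Euclidean) topology, which is zero-dimensional (equivalently for subsets of ℝ: totally disconnected with a basis of clopen sets), dense in ℝ, and σ-compact. Let U be a non-empty open subset of G, let a, b ∈ U be distinct points, and let c, d ∈ G satisfy c < d. Then there exists a homeomorphism h from U onto [c, d] ∩ G such that h(a) = c and h(b) = d. -/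
open Set Topology Filter MeasureTheory Function
open scoped NNReal ENNReal

theorem volume_eq_zero_of_totallyDisconnected (G : AddSubgroup ℝ) [TotallyDisconnectedSpace G]
    [SigmaCompactSpace G] : volume (G : Set ℝ) = 0 := by
  by_contra h
  have hmeas : MeasurableSet (G : Set ℝ) := by
    have : IsSigmaCompact (G : Set ℝ) := by
      rw [isSigmaCompact_iff_isSigmaCompact_univ]
      exact isSigmaCompact_univ
    obtain ⟨K, hK, hKG⟩ := this
    rw [← hKG]
    exact MeasurableSet.iUnion fun n => (hK n).measurableSet
  have h0 : (G : Set ℝ) ∈ 𝓝 (0 : ℝ) := by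
    refine mem_of_superset
      (Measure.sub_mem_nhds_zero_of_addHaar_pos volume (G : Set ℝ) hmeas (pos_iff_ne_zero.2 h)) ?_
    rintro _ ⟨x, hx, y, hy, rfl⟩
    exact G.sub_mem hx hy
  have hopen : IsOpen (G : Set ℝ) := G.isOpen_of_mem_nhds h0
  have huniv : (G : Set ℝ) = univ :=
    IsClopen.eq_univ ⟨G.isClosed_of_isOpen hopen, hopen⟩ ⟨0, G.zero_mem⟩
  have hpre : IsPreconnected (univ : Set G) := by
    rw [← Topology.IsInducing.subtypeVal.isPreconnected_image, image_univ, Subtype.range_coe, huniv]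
    exact isPreconnected_univ
  have h1 : (1 : ℝ) ∈ (G : Set ℝ) := huniv ▸ mem_univ _
  have := hpre.subsingleton (mem_univ (0 : G)) (mem_univ (⟨1, h1⟩ : G))
  simpa using congrArg Subtype.val this

theorem dense_compl_of_volume_eq_zero {s : Set ℝ} (h : volume s = 0) : Dense sᶜ :=
  interior_eq_empty_iff_dense_compl.1 (Measure.interior_eq_empty_of_null h)

theorem dist_ne_of_notMem {G : AddSubgroup ℝ} {r : ℝ} (hr : r ∉ G) (x y : G) : dist x y ≠ r := by
  rintro rfl
  refine hr ?_
  rw [Subtype.dist_eq, Real.dist_eq]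
  rcases abs_choice ((x : ℝ) - y) with h | h <;> rw [h]
  · exact (x - y).2
  · exact (-(x - y)).2

theorem isClopen_dist_lt {G : AddSubgroup ℝ} (x : G) {r : ℝ} (hr : r ∉ G) :
    IsClopen {y : G | dist y x < r} := by
  refine ⟨?_, isOpen_lt (by fun_prop) continuous_const⟩
  convert isClosed_le (f := fun y : G => dist y x) (g := fun _ => r) (by fun_prop) continuous_const
    using 3 with y
  exact ⟨le_of_lt, fun h => h.lt_of_ne (dist_ne_of_notMem hr y x)⟩

theorem isClopen_lt_dist {G : AddSubgroup ℝ} (x : G) {r : ℝ} (hr : r ∉ G) :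
    IsClopen {y : G | r < dist y x} := by
  convert (isClopen_dist_lt x hr).compl using 1
  ext y
  rw [mem_compl_iff, mem_ofPred_eq, mem_ofPred_eq, not_lt]
  exact ⟨le_of_lt, fun h => h.lt_of_ne' (dist_ne_of_notMem hr y x)⟩

/-- An open subset of a null subgroup of `ℝ` is a union of clopen sets contained in intervals of
arbitrarily small total length. -/
theorem exists_clopen_cover {G : AddSubgroup ℝ} (hG : volume (G : Set ℝ) = 0) {U : Set G}
    (hU : IsOpen U) {ε : ℝ≥0∞} (hε : ε ≠ 0) :
    ∃ (A : ℕ → Set G) (u : ℕ → ℝ) (l : ℕ → ℝ≥0), (∀ i, IsClopen (A i)) ∧ ⋃ i, A i = U ∧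
      (∀ i, ∀ x ∈ A i, u i ≤ x ∧ x ≤ u i + l i) ∧ ∑' i, (l i : ℝ≥0∞) ≤ ε := by
  have hD := dense_compl_of_volume_eq_zero hG
  obtain ⟨t, r, ht, htU, hr, hcov, hsum⟩ :=
    Besicovitch.exists_closedBall_covering_tsum_measure_le volume hε
      (fun x => {r : ℝ | r ∉ G ∧ 0 < r ∧ ∀ y : G, dist (y : ℝ) x < r → y ∈ U})
      (Subtype.val '' U) (by
        rintro _ ⟨x, hx, rfl⟩ δ hδ
        obtain ⟨η, hη, hball⟩ := Metric.isOpen_iff.1 hU x hx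
        obtain ⟨r, hrG, hr0, hr⟩ := hD.exists_between (lt_min hδ hη)
        exact ⟨r, ⟨hrG, hr0, fun y hy => hball (hy.trans (hr.trans_le (min_le_right _ _)))⟩,
          hr0, hr.trans_le (min_le_left _ _)⟩)
  have hnull : volume (Subtype.val '' U : Set ℝ) = 0 :=
    measure_mono_null (by rintro _ ⟨x, -, rfl⟩; exact x.2) hG
  rw [hnull, zero_add] at hsum
  have := ht.to_subtype
  obtain ⟨f, hf⟩ := exists_injective_nat t
  have htG : ∀ x : t, (x : ℝ) ∈ G := fun x => by
    obtain ⟨y, -, hy⟩ := htU x.2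
    exact hy ▸ y.2
  let B : t → Set G := fun x => {y : G | dist y ⟨x, htG x⟩ < r x}
  let l : t → ℝ≥0 := fun x => (2 * r x).toNNReal
  refine ⟨extend f B fun _ => ∅, extend f (fun x => (x : ℝ) - r x) 0, extend f l 0, ?_, ?_, ?_, ?_⟩
  · intro i
    by_cases hi : ∃ x, f x = i
    · obtain ⟨x, rfl⟩ := hi
      rw [hf.extend_apply]
      exact isClopen_dist_lt _ (hr x x.2).1
    · rw [extend_apply' _ _ _ hi]
      exact isClopen_empty
  · apply Subset.antisymm
    · refine iUnion_subset fun i y hy => ?_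
      by_cases hi : ∃ x, f x = i
      · obtain ⟨x, rfl⟩ := hi
        rw [hf.extend_apply] at hy
        exact (hr x x.2).2.2 y hy
      · rw [extend_apply' _ _ _ hi] at hy
        exact hy.elim
    · intro y hy
      obtain ⟨x, hx, hxy⟩ := mem_iUnion₂.1 (hcov ⟨y, hy, rfl⟩)
      refine mem_iUnion.2 ⟨f ⟨x, hx⟩, ?_⟩
      rw [hf.extend_apply]
      exact lt_of_le_of_ne (Metric.mem_closedBall.1 hxy)
        (dist_ne_of_notMem (hr x hx).1 y ⟨x, htG ⟨x, hx⟩⟩)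
  · intro i y hy
    by_cases hi : ∃ x, f x = i
    · obtain ⟨x, rfl⟩ := hi
      simp only [hf.extend_apply] at hy ⊢
      have h0 := (hr x x.2).2.1
      have : |(y : ℝ) - x| < r x := hy
      rw [abs_lt] at this
      rw [Real.coe_toNNReal _ (by linarith)]
      constructor <;> linarith
    · rw [extend_apply' _ _ _ hi] at hy
      exact hy.elim
  · refine le_of_eq_of_le ?_ hsum
    calc ∑' i, ((extend f l 0 i : ℝ≥0) : ℝ≥0∞)
        = ∑' i, extend f (fun x => (l x : ℝ≥0∞)) 0 i := by
          congr 1 with i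
          by_cases hi : ∃ x, f x = i
          · obtain ⟨x, rfl⟩ := hi
            simp only [hf.extend_apply]
          · simp only [extend_apply' _ _ _ hi, Pi.zero_apply, ENNReal.coe_zero]
      _ = ∑' x, (l x : ℝ≥0∞) := tsum_extend_zero hf _
      _ = _ := by
          congr 1 with x
          rw [Real.volume_closedBall]
          rfl

/-- Countably many copies of an open subset of a null subgroup of `ℝ` can be partitioned into
clopen sets contained in intervals of arbitrarily small total length; the piece `P j` belongs to
the copy number `N j`. -/
theorem exists_clopen_copies {G : AddSubgroup ℝ} (hG : volume (G : Set ℝ) = 0) {U : Set G}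
    (hU : IsOpen U) {ε : ℝ≥0∞} (hε : ε ≠ 0) :
    ∃ (P : ℕ → Set G) (N : ℕ → ℕ) (u : ℕ → ℝ) (l : ℕ → ℝ≥0), (∀ j, IsClopen (P j)) ∧
      (∀ j, P j ⊆ U) ∧ (∀ n, ∀ x ∈ U, ∃! j, N j = n ∧ x ∈ P j) ∧
      (∀ j, ∀ x ∈ P j, u j ≤ x ∧ x ≤ u j + l j) ∧ ∑' j, (l j : ℝ≥0∞) ≤ ε := by
  obtain ⟨δ, hδ, hδε⟩ := ENNReal.exists_pos_sum_of_countable hε ℕ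
  choose A u l hA hAU hb hl using fun n =>
    exists_clopen_cover hG hU (ENNReal.coe_ne_zero.2 (hδ n).ne')
  refine ⟨fun j => disjointed (A j.unpair.1) j.unpair.2, fun j => j.unpair.1,
    fun j => u j.unpair.1 j.unpair.2, fun j => l j.unpair.1 j.unpair.2, ?_, ?_, ?_, ?_, ?_⟩
  · exact fun j => disjointedRec (p := IsClopen) (fun t i ht => ht.diff (hA _ i)) (hA _ _)
  · exact fun j => (disjointed_subset _ _).trans ((subset_iUnion _ _).trans (hAU _).subset)
  · intro n x hx
    rw [← hAU n, ← iUnion_disjointed] at hx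
    obtain ⟨i, hi⟩ := mem_iUnion.1 hx
    refine ⟨Nat.pair n i, by simpa using hi, ?_⟩
    rintro j ⟨rfl, hj⟩
    have : j.unpair.2 = i := by
      by_contra hne
      exact (disjoint_disjointed (A j.unpair.1) hne).ne_of_mem hj hi rfl
    rw [← this, Nat.pair_unpair]
  · exact fun j x hx => hb _ _ x (disjointed_subset _ _ hx)
  · calc ∑' j : ℕ, (l j.unpair.1 j.unpair.2 : ℝ≥0∞)
        = ∑' p : ℕ × ℕ, (l p.1 p.2 : ℝ≥0∞) :=
          Nat.pairEquiv.symm.tsum_eq fun p : ℕ × ℕ => (l p.1 p.2 : ℝ≥0∞)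
      _ = ∑' n, ∑' i, (l n i : ℝ≥0∞) :=
          ENNReal.tsum_prod (f := fun n i => (l n i : ℝ≥0∞))
      _ ≤ ∑' n, (δ n : ℝ≥0∞) := ENNReal.tsum_le_tsum hl
      _ ≤ ε := hδε.le

/-- Closed sets of small total length can be translated to disjoint sets just below a point `y`
outside the group, in such a way that the union of the translates is closed. -/
theorem exists_translates {G : AddSubgroup ℝ} (hdense : Dense (G : Set ℝ)) {P : ℕ → Set G}
    {u : ℕ → ℝ} {l : ℕ → ℝ≥0} (hP : ∀ j, IsClosed (P j))
    (hb : ∀ j, ∀ x ∈ P j, u j ≤ x ∧ x ≤ u j + l j) {ε : ℝ} (hε : 0 < ε)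
    (hl : ∑' j, (l j : ℝ≥0∞) ≤ ENNReal.ofReal (ε / 4)) {y : ℝ} (hy : y ∉ G) :
    ∃ g : ℕ → G, Pairwise (Disjoint on fun j => (· + g j) '' P j) ∧
      (∀ j, ∀ x ∈ P j, y - ε < x + g j ∧ (x + g j : ℝ) < y) ∧
      IsClosed (⋃ j, (· + g j) '' P j) := by
  obtain ⟨δ, hδ, hδε⟩ := ENNReal.exists_pos_sum_of_countable
    (ε := ENNReal.ofReal (ε / 4)) (by simpa using hε) ℕ
  let w : ℕ → ℝ≥0 := fun j => l j + δ j
  have hwlt : ∑' j, (w j : ℝ≥0∞) ≤ ENNReal.ofReal (ε / 2) := by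
    calc ∑' j, (w j : ℝ≥0∞) = ∑' j, (l j : ℝ≥0∞) + ∑' j, (δ j : ℝ≥0∞) := by
          rw [← ENNReal.tsum_add]; simp [w]
      _ ≤ ENNReal.ofReal (ε / 4) + ENNReal.ofReal (ε / 4) := add_le_add hl hδε.le
      _ = ENNReal.ofReal (ε / 2) := by
          rw [← ENNReal.ofReal_add (by positivity) (by positivity)]; congr 1; ring
  have hws : Summable w := ENNReal.tsum_coe_ne_top_iff_summable.1 (hwlt.trans_lt (by simp)).ne
  have hT : ((∑' j, w j : ℝ≥0) : ℝ) ≤ ε / 2 := by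
    rw [← ENNReal.coe_tsum hws] at hwlt
    have := ENNReal.toReal_mono ENNReal.ofReal_ne_top hwlt
    rwa [ENNReal.toReal_ofReal (by positivity)] at this
  set T : ℝ := ((∑' j, w j : ℝ≥0) : ℝ) with hTdef
  let X : ℕ → ℝ := fun n => y - T + ∑ j ∈ Finset.range n, (w j : ℝ)
  have hXs : ∀ n, X (n + 1) = X n + (l n + δ n) := fun n => by
    simp [X, w, Finset.sum_range_succ, add_assoc]
  have hXmono : Monotone X := monotone_nat_of_le_succ fun n => by
    rw [hXs]; exact le_add_of_nonneg_right (by positivity)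
  have hXlim : Tendsto X atTop (𝓝 y) := by
    have h1 : HasSum (fun j => (w j : ℝ)) T := NNReal.hasSum_coe.2 hws.hasSum
    simpa [X] using h1.tendsto_sum_nat.const_add (y - T)
  have hXy : ∀ n, X n ≤ y := hXmono.ge_of_tendsto hXlim
  have hX0 : ∀ n, y - ε < X n := fun n => by
    have : X 0 ≤ X n := hXmono n.zero_le
    have h0 : X 0 = y - T := by simp [X]
    linarith
  have hg : ∀ j, ∃ g : G, X j - u j < g ∧ (g : ℝ) < X j - u j + δ j := fun j => by
    obtain ⟨z, hz, h1, h2⟩ := hdense.exists_between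
      (show X j - u j < X j - u j + δ j from lt_add_of_pos_right _ (by exact_mod_cast hδ j))
    exact ⟨⟨z, hz⟩, h1, h2⟩
  choose g hg1 hg2 using hg
  have hmem : ∀ j, ∀ x ∈ P j, X j < x + g j ∧ (x + g j : ℝ) < X (j + 1) := fun j x hx => by
    have := hb j x hx
    have := hg1 j
    have := hg2 j
    rw [hXs]
    constructor <;> linarith
  refine ⟨g, ?_, ?_, ?_⟩
  · refine (symm_disjoint.comap _).pairwise_on _ |>.2 ?_
    intro i j hij
    refine Set.disjoint_left.2 ?_
    rintro _ ⟨x, hx, rfl⟩ ⟨x', hx', h⟩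
    have h1 := (hmem i x hx).2
    have h2 := (hmem j x' hx').1
    have h3 : X (i + 1) ≤ X j := hXmono hij
    have h4 : (x' + g j : ℝ) = x + g i := congrArg Subtype.val h
    linarith
  · exact fun j x hx => ⟨(hX0 j).trans (hmem j x hx).1, (hmem j x hx).2.trans_le (hXy _)⟩
  · refine LocallyFinite.isClosed_iUnion ?_ fun j => (Homeomorph.addRight (g j)).isClosedMap _ (hP j)
    intro z
    rcases lt_or_gt_of_ne (fun h => hy (h ▸ z.2) : (z : ℝ) ≠ y) with hz | hz
    · obtain ⟨n, hn⟩ := (hXlim.eventually (lt_mem_nhds hz)).exists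
      refine ⟨{x | (x : ℝ) < X n}, (isOpen_lt (by fun_prop) continuous_const).mem_nhds hn,
        (finite_lt_nat n).subset ?_⟩
      rintro j ⟨_, ⟨x, hx, rfl⟩, hxn⟩
      by_contra hj
      exact absurd (((hXmono (not_lt.1 hj)).trans_lt (hmem j x hx).1).trans hxn) (lt_irrefl _)
    · refine ⟨{x | y < (x : ℝ)}, (isOpen_lt continuous_const (by fun_prop)).mem_nhds hz,
        finite_empty.subset ?_⟩
      rintro j ⟨_, ⟨x, hx, rfl⟩, hxn⟩
      exact absurd (((hmem j x hx).2.trans_le (hXy _)).trans hxn) (lt_irrefl _)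

theorem nonempty_sigma_homeomorph {X : Type*} [TopologicalSpace X] {U : Set X} {P : ℕ → Set X}
    {N : ℕ → ℕ} (hP : ∀ j, IsOpen (P j)) (hPU : ∀ j, P j ⊆ U)
    (hN : ∀ n, ∀ x ∈ U, ∃! j, N j = n ∧ x ∈ P j) : Nonempty ((Σ j, P j) ≃ₜ ℕ × U) := by
  let f : (Σ j, P j) → ℕ × U := fun p => (N p.1, ⟨p.2, hPU _ p.2.2⟩)
  have hf : IsHomeomorph f := by
    refine ⟨continuous_sigma fun j =>
      by
      simp only [f]
      fun_prop, isOpenMap_sigma.2 fun j => ?_, ?_, ?_⟩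
    · have h1 : IsOpenMap fun x : P j => (⟨x, hPU _ x.2⟩ : U) :=
        (hP j).isOpenMap_inclusion (hPU j)
      have h2 : IsOpenMap fun x : U => (N j, x) := by
        intro s hs
        convert (isOpen_discrete {N j}).prod hs using 1
        ext ⟨n, x⟩
        constructor
        · rintro ⟨z, hz, h⟩
          obtain ⟨rfl, rfl⟩ := Prod.mk.inj h
          exact ⟨rfl, hz⟩
        · rintro ⟨rfl, hx⟩
          exact ⟨x, hx, rfl⟩
      exact h2.comp h1
    · rintro ⟨i, x, hx⟩ ⟨j, z, hz⟩ h
      simp only [f, Prod.mk.injEq, Subtype.mk.injEq] at h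
      obtain ⟨h1, rfl⟩ := h
      obtain rfl : i = j := (hN _ x (hPU _ hx)).unique ⟨h1, hx⟩ ⟨rfl, hz⟩
      rfl
    · rintro ⟨n, x, hx⟩
      obtain ⟨j, ⟨rfl, hj⟩, -⟩ := hN n x hx
      exact ⟨⟨j, x, hj⟩, rfl⟩
  exact ⟨hf.homeomorph f⟩

/-- Splitting off the zeroth copy of `X` from `ℕ × X`. -/
noncomputable def natProdHomeomorph (X : Type*) [TopologicalSpace X] : ℕ × X ≃ₜ X ⊕ ℕ × X :=
  (((Homeomorph.ofDiscrete Equiv.natSumPUnitEquivNat.{0}.symm).prodCongr (.refl X)).trans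
    Homeomorph.sumProdDistrib).trans
    ((Homeomorph.sumComm _ _).trans ((Homeomorph.punitProd X).sumCongr (.refl _)))

theorem nonempty_homeomorph_sum {G : AddSubgroup ℝ} (hG : volume (G : Set ℝ) = 0)
    (hdense : Dense (G : Set ℝ)) {U V : Set G} (hU : IsOpen U) (hV : IsOpen V)
    (hVne : V.Nonempty) : Nonempty (V ≃ₜ U ⊕ V) := by
  obtain ⟨v, hv⟩ := hVne
  obtain ⟨η, hη, hball⟩ := Metric.isOpen_iff.1 hV v hv
  obtain ⟨y, hy, hy1, hy2⟩ := (dense_compl_of_volume_eq_zero hG).exists_between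
    (show (v : ℝ) < v + η from lt_add_of_pos_right _ hη)
  obtain ⟨P, N, u, l, hP, hPU, hN, hb, hl⟩ := exists_clopen_copies hG hU
    (ε := ENNReal.ofReal ((y - v) / 4)) (by simpa using hy1)
  obtain ⟨g, hdisj, hgV, hclosed⟩ :=
    exists_translates hdense (fun j => (hP j).isClosed) hb (sub_pos.2 hy1) hl hy
  have hsub : ⋃ j, (· + g j) '' P j ⊆ V := by
    refine iUnion_subset fun j => ?_
    rintro _ ⟨x, hx, rfl⟩
    apply hball
    have := hgV j x hx
    rw [Metric.mem_ball, Subtype.dist_eq, Real.dist_eq, abs_lt]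
    simp only [AddSubgroup.coe_add]
    constructor <;> linarith
  let R : Set G := V \ ⋃ j, (· + g j) '' P j
  have hR : IsOpen R := hV.sdiff hclosed
  let f : (Σ j, P j) ⊕ R → G := Sum.elim (fun p => p.2 + g p.1) (↑)
  have hf : IsOpenEmbedding f := by
    refine .of_continuous_injective_isOpenMap ?_ ?_ ?_
    · exact continuous_sum_dom.2 ⟨continuous_sigma fun j =>
        by simpa [f] using by fun_prop, continuous_subtype_val⟩
    · refine Injective.sumElim ?_ Subtype.val_injective ?_
      · rintro ⟨i, x, hx⟩ ⟨j, z, hz⟩ h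
        obtain rfl : i = j := by
          by_contra hne
          exact (hdisj hne).ne_of_mem ⟨x, hx, rfl⟩ ⟨z, hz, rfl⟩ h
        obtain rfl : x = z := add_right_cancel h
        rfl
      · rintro ⟨j, x, hx⟩ ⟨z, -, hz⟩ rfl
        exact hz (mem_iUnion.2 ⟨j, x, hx, rfl⟩)
    · refine isOpenMap_sumElim.2 ⟨isOpenMap_sigma.2 fun j => ?_, hR.isOpenMap_subtype_val⟩
      exact (Homeomorph.addRight (g j)).isOpenMap.comp (hP j).isOpen.isOpenMap_subtype_val
  have hrange : range f = V := by
    rw [Set.Sum.elim_range, Subtype.range_coe, ← union_sdiff_cancel hsub]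
    congr 1
    ext x
    simp only [mem_range, Sigma.exists, Subtype.exists, mem_iUnion, mem_image, exists_prop]
  obtain ⟨e⟩ := nonempty_sigma_homeomorph (fun j => (hP j).isOpen) hPU hN
  have e₁ : V ≃ₜ (ℕ × U) ⊕ R := ((Homeomorph.setCongr hrange.symm).trans
    hf.toIsEmbedding.toHomeomorph.symm).trans (e.sumCongr (.refl _))
  exact ⟨(e₁.trans (((natProdHomeomorph U).sumCongr (.refl _)).trans
    (Homeomorph.sumAssoc _ _ _))).trans ((Homeomorph.refl U).sumCongr e₁.symm)⟩

/-- Any two nonempty open subsets of a null dense subgroup of `ℝ` are homeomorphic. -/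
theorem nonempty_homeomorph_of_isOpen {G : AddSubgroup ℝ} (hG : volume (G : Set ℝ) = 0)
    (hdense : Dense (G : Set ℝ)) {U V : Set G} (hU : IsOpen U) (hV : IsOpen V)
    (hUne : U.Nonempty) (hVne : V.Nonempty) : Nonempty (U ≃ₜ V) := by
  obtain ⟨e₁⟩ := nonempty_homeomorph_sum hG hdense hU hV hVne
  obtain ⟨e₂⟩ := nonempty_homeomorph_sum hG hdense hV hU hUne
  exact ⟨e₂.trans ((Homeomorph.sumComm _ _).trans e₁.symm)⟩

/-- The sets `A n` are nonempty, open and partition `S \ {s}`, and `A n` lies in the annulus around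
`s` with radii `r n` and `r (n - 1)` (with no outer radius when `n = 0`). -/
structure IsAnnularPartition {X : Type*} [PseudoMetricSpace X] (r : ℕ → ℝ) (S : Set X) (s : X)
    (A : ℕ → Set X) : Prop where
  isOpen : ∀ n, IsOpen (A n)
  nonempty : ∀ n, (A n).Nonempty
  disjoint : Pairwise (Disjoint on A)
  iUnion_eq : ⋃ n, A n = S \ {s}
  lt_dist : ∀ n, ∀ x ∈ A n, r n < dist x s
  dist_le : ∀ m n, m < n → ∀ x ∈ A n, dist x s ≤ r m

namespace IsAnnularPartition

variable {X : Type*} [PseudoMetricSpace X] {r : ℕ → ℝ} {S S' : Set X} {s s' : X}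
  {A A' : ℕ → Set X}

theorem subset (h : IsAnnularPartition r S s A) (n : ℕ) : A n ⊆ S :=
  fun _ hx => (h.iUnion_eq.subset (mem_iUnion.2 ⟨n, hx⟩)).1

theorem continuous_of_forall (h : IsAnnularPartition r S s A) (h' : IsAnnularPartition r S' s' A')
    (hr : Antitone r) (hr0 : ∀ n, 0 < r n) (hlim : Tendsto r atTop (𝓝 0)) {hs : s ∈ S}
    {F : S → S'} (hFs : (F ⟨s, hs⟩ : X) = s') (f : ∀ n, A n → A' n) (hf : ∀ n, Continuous (f n))
    (hF : ∀ n (x : A n), (F ⟨x, h.subset n x.2⟩ : X) = f n x) : Continuous F := by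
  refine continuous_iff_continuousAt.2 fun ⟨x, hx⟩ => ?_
  by_cases hxs : x = s
  · subst hxs
    refine Metric.continuousAt_iff.2 fun ε hε => ?_
    obtain ⟨n, hn⟩ := (hlim.eventually (gt_mem_nhds hε)).exists
    refine ⟨r n, hr0 n, fun {z} hz => ?_⟩
    rw [Subtype.dist_eq] at hz ⊢
    rw [hFs]
    by_cases hzx : (z : X) = x
    · obtain rfl : z = ⟨x, hx⟩ := Subtype.ext hzx
      rwa [hFs, dist_self]
    · obtain ⟨m, hm⟩ := mem_iUnion.1 (h.iUnion_eq.symm.subset ⟨z.2, hzx⟩)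
      have hnm : n < m := by
        by_contra hmn
        exact absurd ((h.lt_dist m z hm).trans (hz.trans_le (hr (not_lt.1 hmn)))) (lt_irrefl _)
      have := hF m ⟨z, hm⟩
      rw [this]
      exact (h'.dist_le n m hnm _ (f m _).2).trans_lt hn
  · obtain ⟨n, hn⟩ := mem_iUnion.1 (h.iUnion_eq.symm.subset ⟨hx, hxs⟩)
    have hemb : IsOpenEmbedding (inclusion (h.subset n)) :=
      ⟨.inclusion _, by
        rw [range_inclusion]
        exact (h.isOpen n).preimage continuous_subtype_val⟩
    refine (hemb.continuousAt_iff (x := ⟨x, hn⟩)).1 (Continuous.continuousAt ?_)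
    refine continuous_induced_rng.2 ?_
    convert continuous_subtype_val.comp (hf n) using 1
    exact funext (hF n)

theorem bijective_elim (h : IsAnnularPartition r S s A) (hs : s ∈ S) :
    Bijective fun p : Option (Σ n, A n) =>
      p.elim (⟨s, hs⟩ : S) fun q => ⟨q.2, h.subset q.1 q.2.2⟩ := by
  have hne : ∀ n, ∀ x ∈ A n, x ≠ s := fun n x hx =>
    (h.iUnion_eq.subset (mem_iUnion.2 ⟨n, hx⟩)).2
  constructor
  · rintro (_ | ⟨m, x, hx⟩) (_ | ⟨n, z, hz⟩) hxz
    · rfl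
    · exact absurd (congrArg Subtype.val hxz).symm (hne n z hz)
    · exact absurd (congrArg Subtype.val hxz) (hne m x hx)
    · obtain rfl : x = z := congrArg Subtype.val hxz
      obtain rfl : m = n := by
        by_contra hmn
        exact (h.disjoint hmn).ne_of_mem hx hz rfl
      rfl
  · rintro ⟨x, hx⟩
    by_cases hxs : x = s
    · exact ⟨none, Subtype.ext hxs.symm⟩
    · obtain ⟨n, hn⟩ := mem_iUnion.1 (h.iUnion_eq.symm.subset ⟨hx, hxs⟩)
      exact ⟨some ⟨n, x, hn⟩, rfl⟩

theorem exists_homeomorph (h : IsAnnularPartition r S s A) (h' : IsAnnularPartition r S' s' A')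
    (hr : Antitone r) (hr0 : ∀ n, 0 < r n) (hlim : Tendsto r atTop (𝓝 0)) (hs : s ∈ S)
    (hs' : s' ∈ S') (e : ∀ n, A n ≃ₜ A' n) : ∃ E : S ≃ₜ S', E ⟨s, hs⟩ = ⟨s', hs'⟩ := by
  let φ := Equiv.ofBijective _ (h.bijective_elim hs)
  let φ' := Equiv.ofBijective _ (h'.bijective_elim hs')
  let ψ : Option (Σ n, A n) ≃ Option (Σ n, A' n) :=
    Equiv.optionCongr (Equiv.sigmaCongrRight fun n => (e n).toEquiv)
  let E : S ≃ S' := (φ.symm.trans ψ).trans φ'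
  have hφs : φ.symm ⟨s, hs⟩ = none := φ.symm_apply_eq.2 rfl
  have hφs' : φ'.symm ⟨s', hs'⟩ = none := φ'.symm_apply_eq.2 rfl
  have hφ : ∀ n (x : A n), φ.symm ⟨x, h.subset n x.2⟩ = some ⟨n, x⟩ :=
    fun n x => φ.symm_apply_eq.2 rfl
  have hφ' : ∀ n (x : A' n), φ'.symm ⟨x, h'.subset n x.2⟩ = some ⟨n, x⟩ :=
    fun n x => φ'.symm_apply_eq.2 rfl
  have hEs : E ⟨s, hs⟩ = ⟨s', hs'⟩ := by
    change φ' (ψ (φ.symm _)) = _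
    rw [hφs]
    rfl
  have hEs' : E.symm ⟨s', hs'⟩ = ⟨s, hs⟩ := E.symm_apply_eq.2 hEs.symm
  refine ⟨⟨E, ?_, ?_⟩, hEs⟩
  · refine h.continuous_of_forall h' hr hr0 hlim (congrArg Subtype.val hEs) (fun n => e n)
      (fun n => (e n).continuous) fun n x => ?_
    change (φ' (ψ (φ.symm _)) : X) = _
    rw [hφ]
    rfl
  · refine h'.continuous_of_forall h hr hr0 hlim (congrArg Subtype.val hEs') (fun n => (e n).symm)
      (fun n => (e n).symm.continuous) fun n x => ?_
    change (φ (ψ.symm (φ'.symm _)) : X) = _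
    rw [hφ']
    rfl

end IsAnnularPartition

theorem exists_isAnnularPartition {G : AddSubgroup ℝ} {r : ℕ → ℝ} (hr : StrictAnti r)
    (hr0 : ∀ n, 0 < r n) (hlim : Tendsto r atTop (𝓝 0)) (hrG : ∀ n, r n ∉ G) {S : Set G} {s : G}
    (hS : IsOpen (S \ {s})) {η : ℝ} (hη : r 0 < η)
    (hann : ∀ p q, 0 < p → p < q → q ≤ η → ∃ x ∈ S, p < dist x s ∧ dist x s < q) :
    ∃ A, IsAnnularPartition r S s A := by
  let D : ℕ → Set G := fun n => {x | r n < dist x s}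
  have hD : ∀ n, IsClopen (D n) := fun n => isClopen_lt_dist s (hrG n)
  have hmono : Monotone D := fun m n hmn x hx => (hr.antitone hmn).trans_lt hx
  refine ⟨fun n => (S \ {s}) ∩ disjointed D n, fun n => hS.inter ?_, fun n => ?_,
    fun m n hmn => (disjoint_disjointed D hmn).mono inter_subset_right inter_subset_right, ?_,
    fun n x hx => disjointed_subset D n hx.2, fun m n hmn x hx => ?_⟩
  · exact (disjointedRec (p := IsClopen) (fun t i ht => ht.diff (hD i)) (hD n)).isOpen
  · have hpos : ∀ x : G, r n < dist x s → x ≠ s := by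
      rintro x hx rfl
      exact absurd (hx.trans_eq (dist_self _)) (hr0 n).not_gt
    cases n with
    | zero =>
      obtain ⟨x, hx, h1, -⟩ := hann (r 0) η (hr0 0) hη le_rfl
      exact ⟨x, ⟨hx, hpos x h1⟩, by rwa [disjointed_zero]⟩
    | succ n =>
      obtain ⟨x, hx, h1, h2⟩ := hann (r (n + 1)) (r n) (hr0 _) (hr n.lt_succ_self)
        ((hr.antitone n.zero_le).trans hη.le)
      refine ⟨x, ⟨hx, hpos x h1⟩, ?_⟩
      rw [← Order.succ_eq_add_one, hmono.disjointed_succ (not_isMax n)]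
      exact ⟨h1, h2.not_gt⟩
  · rw [← inter_iUnion, iUnion_disjointed]
    refine inter_eq_left.2 fun x hx => ?_
    obtain ⟨n, hn⟩ := (hlim.eventually (gt_mem_nhds (dist_pos.2 hx.2))).exists
    exact mem_iUnion.2 ⟨n, hn⟩
  · have := hx.2
    rw [disjointed_eq_inter_compl] at this
    exact not_lt.1 (mem_iInter₂.1 this.2 m hmn)

theorem exists_pointed_homeomorph {G : AddSubgroup ℝ} (hG : volume (G : Set ℝ) = 0)
    (hdense : Dense (G : Set ℝ)) {S S' : Set G} {s s' : G} (hs : s ∈ S) (hs' : s' ∈ S')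
    (hS : IsOpen (S \ {s})) (hS' : IsOpen (S' \ {s'}))
    (hann : ∃ η > 0, ∀ p q, 0 < p → p < q → q ≤ η → ∃ x ∈ S, p < dist x s ∧ dist x s < q)
    (hann' : ∃ η > 0, ∀ p q, 0 < p → p < q → q ≤ η → ∃ x ∈ S', p < dist x s' ∧ dist x s' < q) :
    ∃ E : S ≃ₜ S', E ⟨s, hs⟩ = ⟨s', hs'⟩ := by
  obtain ⟨η, hη, hann⟩ := hann
  obtain ⟨η', hη', hann'⟩ := hann'
  obtain ⟨r, hr, hrG, hlim⟩ := (dense_compl_of_volume_eq_zero hG).exists_seq_strictAnti_tendsto_of_lt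
    (lt_min hη hη')
  have hr0 : ∀ n, 0 < r n := fun n => (hrG n).1.1
  have hlt := (hrG 0).1.2
  have hrG' : ∀ n, r n ∉ G := fun n => (hrG n).2
  obtain ⟨A, hA⟩ := exists_isAnnularPartition hr hr0 hlim hrG' hS
    (hlt.trans_le (min_le_left _ _)) hann
  obtain ⟨A', hA'⟩ := exists_isAnnularPartition hr hr0 hlim hrG' hS'
    (hlt.trans_le (min_le_right _ _)) hann'
  exact hA.exists_homeomorph hA' hr.antitone hr0 hlim hs hs' fun n =>
    (nonempty_homeomorph_of_isOpen hG hdense (hA.isOpen n) (hA'.isOpen n) (hA.nonempty n)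
      (hA'.nonempty n)).some

theorem exists_mem_annulus_of_right {G : AddSubgroup ℝ} (hdense : Dense (G : Set ℝ)) {S : Set G}
    {s : G} {η : ℝ} (hη : 0 < η) (hS : ∀ x : G, (s : ℝ) < x → (x : ℝ) < s + η → x ∈ S) :
    ∃ η > 0, ∀ p q, 0 < p → p < q → q ≤ η → ∃ x ∈ S, p < dist x s ∧ dist x s < q := by
  refine ⟨η, hη, fun p q hp hpq hq => ?_⟩
  obtain ⟨x, hx, h1, h2⟩ := hdense.exists_between (add_lt_add_right hpq (s : ℝ))
  refine ⟨⟨x, hx⟩, hS _ (by simp; linarith) (by simp; linarith), ?_⟩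
  rw [Subtype.dist_eq, Real.dist_eq, abs_of_pos (by simp; linarith)]
  simp only
  constructor <;> linarith

theorem exists_mem_annulus_of_left {G : AddSubgroup ℝ} (hdense : Dense (G : Set ℝ)) {S : Set G}
    {s : G} {η : ℝ} (hη : 0 < η) (hS : ∀ x : G, (s : ℝ) - η < x → (x : ℝ) < s → x ∈ S) :
    ∃ η > 0, ∀ p q, 0 < p → p < q → q ≤ η → ∃ x ∈ S, p < dist x s ∧ dist x s < q := by
  refine ⟨η, hη, fun p q hp hpq hq => ?_⟩
  obtain ⟨x, hx, h1, h2⟩ := hdense.exists_between (sub_lt_sub_left hpq (s : ℝ))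
  refine ⟨⟨x, hx⟩, hS _ (by simp; linarith) (by simp; linarith), ?_⟩
  rw [Subtype.dist_eq, Real.dist_eq, abs_of_neg (by simp; linarith)]
  simp only
  constructor <;> linarith

theorem exists_mem_annulus_of_isOpen {G : AddSubgroup ℝ} (hdense : Dense (G : Set ℝ)) {S : Set G}
    (hS : IsOpen S) {s : G} (hs : s ∈ S) :
    ∃ η > 0, ∀ p q, 0 < p → p < q → q ≤ η → ∃ x ∈ S, p < dist x s ∧ dist x s < q := by
  obtain ⟨η, hη, hball⟩ := Metric.isOpen_iff.1 hS s hs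
  refine exists_mem_annulus_of_right hdense hη fun x h1 h2 => hball ?_
  rw [Metric.mem_ball, Subtype.dist_eq, Real.dist_eq, abs_lt]
  constructor <;> linarith

theorem exists_homeomorph_sum_of_isClopen {X : Type*} [TopologicalSpace X] {C : Set X}
    (hC : IsClopen C) (S : Set X) : ∃ e : ↥(S ∩ C) ⊕ ↥(S \ C) ≃ₜ S,
      (∀ x, e (.inl x) = ⟨x, x.2.1⟩) ∧ ∀ x, e (.inr x) = ⟨x, x.2.1⟩ := by
  let f : ↥(S ∩ C) ⊕ ↥(S \ C) → S :=
    Sum.elim (inclusion inter_subset_left) (inclusion sdiff_subset)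
  have hf : IsHomeomorph f := by
    refine ⟨?_, isOpenMap_sumElim.2 ⟨?_, ?_⟩, Injective.sumElim (inclusion_injective _)
      (inclusion_injective _) ?_, ?_⟩
    · exact continuous_sum_dom.2 ⟨continuous_inclusion inter_subset_left,
        continuous_inclusion sdiff_subset⟩
    · refine IsOpenEmbedding.isOpenMap ⟨.inclusion _, ?_⟩
      rw [range_inclusion]
      convert hC.isOpen.preimage (continuous_subtype_val (p := (· ∈ S))) using 1
      ext x
      simp
    · refine IsOpenEmbedding.isOpenMap ⟨.inclusion _, ?_⟩
      rw [range_inclusion]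
      convert hC.compl.isOpen.preimage (continuous_subtype_val (p := (· ∈ S))) using 1
      ext x
      simp
    · rintro x z h
      have : (x : X) = z := congrArg Subtype.val h
      exact z.2.2 (this ▸ x.2.2)
    · intro x
      by_cases hx : (x : X) ∈ C
      · exact ⟨.inl ⟨x, x.2, hx⟩, rfl⟩
      · exact ⟨.inr ⟨x, x.2, hx⟩, rfl⟩
  exact ⟨hf.homeomorph f, fun _ => rfl, fun _ => rfl⟩

/-- For a zero-dimensional dense σ-compact subgroup G of ℝ, any nonempty open
U ⊆ G with distinct points a, b can be mapped homeomorphically onto [c, d] ∩ G sending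
a to c and b to d. -/
theorem stmt_2 (G : AddSubgroup ℝ)
    (hzd : TotallyDisconnectedSpace G)
    (hbasis : TopologicalSpace.IsTopologicalBasis {s : Set G | IsClopen s})
    (hdense : Dense (G : Set ℝ))
    (hσ : SigmaCompactSpace G)
    (U : Set G) (hU : IsOpen U)
    (a b : G) (ha : a ∈ U) (hb : b ∈ U) (hab : a ≠ b)
    (c d : G) (hcd : c < d) :
    ∃ h : U ≃ₜ (Set.Icc c d : Set G),
      h ⟨a, ha⟩ = ⟨c, Set.left_mem_Icc.mpr hcd.le⟩ ∧
      h ⟨b, hb⟩ = ⟨d, Set.right_mem_Icc.mpr hcd.le⟩ := by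
  have hG := volume_eq_zero_of_totallyDisconnected G
  have hD := dense_compl_of_volume_eq_zero hG
  obtain ⟨r, hr, hr0, hrb⟩ := hD.exists_between (dist_pos.2 hab.symm)
  obtain ⟨ρ, hρ, hρ0, hρd⟩ := hD.exists_between (dist_pos.2 hcd.ne')
  have hρd' : ρ < d - c := by
    rwa [Subtype.dist_eq, Real.dist_eq, abs_of_pos (sub_pos.2 (Subtype.coe_lt_coe.2 hcd))] at hρd
  have hC := isClopen_dist_lt a hr
  have hK := isClopen_dist_lt c hρ
  set C := {y : G | dist y a < r}
  set K := {y : G | dist y c < ρ} with hKdef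
  have haC : a ∈ U ∩ C := ⟨ha, by simpa [C] using hr0⟩
  have hbC : b ∈ U \ C := ⟨hb, hrb.not_gt⟩
  have hcK : c ∈ Icc c d ∩ K := ⟨left_mem_Icc.2 hcd.le, by simpa [K] using hρ0⟩
  have hdK : d ∈ Icc c d \ K := ⟨right_mem_Icc.2 hcd.le, hρd.not_gt⟩
  have hKmem : ∀ y : G, c ≤ y → (y ∈ K ↔ (y : ℝ) < c + ρ) := fun y hy => by
    rw [hKdef, mem_ofPred_eq, Subtype.dist_eq, Real.dist_eq, 
      abs_of_nonneg (sub_nonneg.2 (Subtype.coe_le_coe.2 hy)), sub_lt_iff_lt_add']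
  have hKc : (Icc c d ∩ K) \ {c} = Ioo c d ∩ K := by
    rw [inter_sdiff_right_comm, Icc_sdiff_left]
    ext y
    refine ⟨fun ⟨⟨h1, h2⟩, h3⟩ => ⟨⟨h1, h2.lt_of_ne ?_⟩, h3⟩, fun ⟨h1, h3⟩ => ⟨⟨h1.1, h1.2.le⟩, h3⟩⟩
    rintro rfl
    exact hdK.2 h3
  have hKd : (Icc c d \ K) \ {d} = Ioo c d \ K := by
    rw [Set.sdiff_sdiff_comm, Icc_sdiff_right]
    ext y
    refine ⟨fun ⟨⟨h1, h2⟩, h3⟩ => ⟨⟨h1.lt_of_ne ?_, h2⟩, h3⟩, fun ⟨h1, h3⟩ => ⟨⟨h1.1.le, h1.2⟩, h3⟩⟩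
    rintro rfl
    exact h3 hcK.2
  obtain ⟨E₁, hE₁⟩ := exists_pointed_homeomorph hG hdense haC hcK
    ((hU.inter hC.isOpen).sdiff isClosed_singleton) (hKc ▸ isOpen_Ioo.inter hK.isOpen)
    (exists_mem_annulus_of_isOpen hdense (hU.inter hC.isOpen) haC)
    (exists_mem_annulus_of_right hdense hρ0 fun x h1 h2 =>
      ⟨⟨le_of_lt h1, Subtype.coe_le_coe.1 (by linarith)⟩, (hKmem x (le_of_lt h1)).2 h2⟩)
  obtain ⟨E₂, hE₂⟩ := exists_pointed_homeomorph hG hdense hbC hdK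
    ((hU.sdiff hC.isClosed).sdiff isClosed_singleton) (hKd ▸ isOpen_Ioo.sdiff hK.isClosed)
    (exists_mem_annulus_of_isOpen hdense (hU.sdiff hC.isClosed) hbC)
    (exists_mem_annulus_of_left (η := d - c - ρ) hdense (sub_pos.2 hρd') fun x h1 h2 => by
      have hcx : c ≤ x := Subtype.coe_le_coe.1 (by linarith)
      exact ⟨⟨hcx, le_of_lt h2⟩, fun h => by have := (hKmem x hcx).1 h; linarith⟩)
  obtain ⟨e, he₁, he₂⟩ := exists_homeomorph_sum_of_isClopen hC U
  obtain ⟨k, hk₁, hk₂⟩ := exists_homeomorph_sum_of_isClopen hK (Icc c d)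
  refine ⟨(e.symm.trans (E₁.sumCongr E₂)).trans k, ?_, ?_⟩
  · have : e.symm ⟨a, ha⟩ = .inl ⟨a, haC⟩ := e.symm_apply_eq.2 (he₁ ⟨a, haC⟩).symm
    simp only [Homeomorph.trans_apply, this]
    change k (.inl (E₁ _)) = _
    rw [hE₁, hk₁]
  · have : e.symm ⟨b, hb⟩ = .inr ⟨b, hbC⟩ := e.symm_apply_eq.2 (he₂ ⟨b, hbC⟩).symm
    simp only [Homeomorph.trans_apply, this]
    change k (.inr (E₂ _)) = _
    rw [hE₂, hk₂]
end

section
/- Let f : ℚ → ℚ be a bijection that is not the identity map, and let p ∈ ℚ satisfy: for every positive integer n there exists a positive integer m such that f^{m+1}((p − 1/n, p + 1/n) ∩ ℚ) intersects f^{−m}((p − 1/n, p + 1/n) ∩ ℚ). Then for every binary operation ⊕ on ℚ such that (ℚ, ⊕) with the subspace Euclidean topology is a topological group and there exists a map that is simultaneously a group isomorphism from (ℚ, +) to (ℚ, ⊕) and a homeomorphism, the map f is not a ⊕-shift; that is, there is no c ∈ ℚ with f(x) = x ⊕ c for all x ∈ ℚ and c not the neutral element of ⊕. -/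
/-- A map that becomes translation by `d` in the coordinate `ψ` has iterates that become
translation by multiples of `d`. -/
theorem iterate_conj_translation {α : Type*} {f : α → α} {ψ : α → ℚ} {d : ℚ}
    (h : ∀ x, ψ (f x) = ψ x + d) (k : ℕ) (x : α) : ψ (f^[k] x) = ψ x + k * d := by
  induction k with
  | zero => simp
  | succ k ih => rw [Function.iterate_succ_apply', h, ih]; push_cast; ring

/-- A continuous map `ℚ → ℚ` varies by less than `ε` on some interval of
radius `1 / n` about `p`. -/
theorem exists_Ioo_one_div_nat_of_continuous {ψ : ℚ → ℚ} (hψ : Continuous ψ) (p : ℚ) {ε : ℚ}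
    (hε : 0 < ε) : ∃ n : ℕ, 0 < n ∧
      ∀ u ∈ Set.Ioo (p - 1 / (n : ℚ)) (p + 1 / (n : ℚ)), |ψ u - ψ p| < ε := by
  have hev : ∀ᶠ u in nhds p, |ψ u - ψ p| < ε :=
    (show Continuous fun u => |ψ u - ψ p| by fun_prop).continuousAt.eventually_lt
      continuousAt_const (by simpa using hε)
  obtain ⟨δ, hδ, hball⟩ := (nhds_basis_abs_sub_lt p).eventually_iff.1 hev
  obtain ⟨n, hn⟩ := exists_nat_one_div_lt hδ
  refine ⟨n + 1, n.succ_pos, fun u hu => hball ?_⟩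
  push_cast at hu
  obtain ⟨hl, hr⟩ := hu
  rw [Set.mem_ofPred_eq, abs_lt]
  constructor <;> linarith

/-- If a non-identity bijection f : ℚ → ℚ satisfies property (*) at a point p
(for every n > 0 there is m > 0 with f^{m+1}((p - 1/n, p + 1/n)) meeting
f^{-m}((p - 1/n, p + 1/n))), then f is not a shift with respect to any group operation on ℚ
making it a topological group topologically isomorphic to (ℚ, +). -/
theorem stmt_3 (f : ℚ → ℚ) (hbij : Function.Bijective f) (hne : f ≠ id)
    (p : ℚ)
    (hstar : ∀ n : ℕ, 0 < n → ∃ m : ℕ, 0 < m ∧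
      ((f^[m + 1] '' Set.Ioo (p - 1 / (n : ℚ)) (p + 1 / (n : ℚ))) ∩
        (f^[m] ⁻¹' Set.Ioo (p - 1 / (n : ℚ)) (p + 1 / (n : ℚ)))).Nonempty) :
    ∀ (op : ℚ → ℚ → ℚ) (e : ℚ) (inv : ℚ → ℚ),
      (∀ a b c : ℚ, op (op a b) c = op a (op b c)) →
      (∀ a : ℚ, op e a = a) → (∀ a : ℚ, op a e = a) →
      (∀ a : ℚ, op (inv a) a = e) →
      Continuous (fun q : ℚ × ℚ => op q.1 q.2) →
      Continuous inv →
      (∃ φ : ℚ ≃ₜ ℚ, ∀ x y : ℚ, φ (x + y) = op (φ x) (φ y)) →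
      ¬ ∃ c : ℚ, c ≠ e ∧ ∀ x : ℚ, f x = op x c := by
  rintro op e inv hassoc hleft - hinv - - ⟨φ, hφ⟩ ⟨c, hce, hf⟩
  have hφ0 : φ 0 = e := by
    have h := hφ 0 0
    rw [add_zero] at h
    rw [← hleft (φ 0), ← hinv (φ 0), hassoc, ← h]
  have hd : φ.symm c ≠ 0 := fun h => hce (by rw [← hφ0, ← h, φ.apply_symm_apply])
  have hshift : ∀ x, φ.symm (f x) = φ.symm x + φ.symm c := fun x => by
    rw [φ.symm_apply_eq, hφ, φ.apply_symm_apply, φ.apply_symm_apply, hf]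
  obtain ⟨n, hn, hsmall⟩ :=
    exists_Ioo_one_div_nat_of_continuous φ.symm.continuous p (half_pos (abs_pos.2 hd))
  obtain ⟨m, -, -, ⟨x, hx, rfl⟩, hy⟩ := hstar n hn
  have hdist := iterate_conj_translation hshift m (f^[m + 1] x)
  rw [iterate_conj_translation hshift (m + 1) x] at hdist
  have hlt : |(2 * m + 1) * φ.symm c| < |φ.symm c| := by
    calc |(2 * m + 1) * φ.symm c|
        = |(φ.symm (f^[m] (f^[m + 1] x)) - φ.symm p) - (φ.symm x - φ.symm p)| := by
          rw [hdist]; push_cast; ring_nf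
      _ ≤ |φ.symm (f^[m] (f^[m + 1] x)) - φ.symm p| + |φ.symm x - φ.symm p| := abs_sub _ _
      _ < |φ.symm c| := by linarith [hsmall _ hy, hsmall _ hx]
  rw [abs_mul, abs_of_pos (by positivity : (0 : ℚ) < 2 * m + 1)] at hlt
  nlinarith [mul_nonneg (Nat.cast_nonneg (α := ℚ) m) (abs_nonneg (φ.symm c))]
end

section
/- There exists a homeomorphism f : ℚ → ℚ (with the subspace Euclidean topology) that is periodic-point free (for every x ∈ ℚ and every integer k ≥ 1, f^k(x) ≠ x) and such that for every binary operation ⊕ on ℚ for which (ℚ, ⊕) with the subspace Euclidean topology is a topological group admitting a map that is simultaneously a group isomorphism from (ℚ, +) to (ℚ, ⊕) and a homeomorphism, f is not a ⊕-shift (there is no non-neutral c with f(x) = x ⊕ c for all x). -/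
/-- The rational points of the interval `(√2 / 3, 2√2)`, a fundamental domain for multiplication
by `6` on the positive rationals. -/
def ratWindow : Set ℚ := {q | √2 / 3 < (q : ℝ) ∧ (q : ℝ) < 2 * √2}

instance ratWindow_ordConnected : ratWindow.OrdConnected := by
  refine ⟨fun x hx y hy z hz => ⟨hx.1.trans_le ?_, lt_of_le_of_lt ?_ hy.2⟩⟩
  · exact_mod_cast hz.1
  · exact_mod_cast hz.2

instance ratWindow_noMaxOrder : NoMaxOrder ratWindow := by
  refine ⟨fun x => ?_⟩
  obtain ⟨q, hq, hq'⟩ := exists_rat_btwn x.2.2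
  exact ⟨⟨q, x.2.1.trans hq, hq'⟩, Subtype.coe_lt_coe.1 (by exact_mod_cast hq)⟩

instance ratWindow_noMinOrder : NoMinOrder ratWindow := by
  refine ⟨fun x => ?_⟩
  obtain ⟨q, hq, hq'⟩ := exists_rat_btwn x.2.1
  exact ⟨⟨q, hq, hq'.trans x.2.2⟩, Subtype.coe_lt_coe.1 (by exact_mod_cast hq')⟩

lemma one_mem_ratWindow : (1 : ℚ) ∈ ratWindow := by
  have h := Real.one_lt_sqrt_two
  have h' := Real.sqrt_two_lt_three_halves
  constructor <;> push_cast <;> linarith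

instance ratWindow_nonempty : Nonempty ratWindow := ⟨⟨1, one_mem_ratWindow⟩⟩

lemma ratCast_ne_sqrt_two (q : ℚ) : (q : ℝ) ≠ √2 :=
  fun h => irrational_sqrt_two ⟨q, h⟩

lemma ratCast_ne_two_thirds_sqrt_two (q : ℚ) : (q : ℝ) ≠ 2 * √2 / 3 := by
  intro h
  apply ratCast_ne_sqrt_two (3 * q / 2)
  push_cast
  linarith

/-- The exchange of the two halves of `ratWindow` on either side of `√2`: multiplication by `2`
modulo powers of `6`. -/
noncomputable def windowExchange : ratWindow ≃ₜ ratWindow where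
  toFun x := ⟨if (x : ℝ) ≤ √2 then 2 * x else x / 3, by
    have h := x.2
    have hne := ratCast_ne_sqrt_two x
    simp only [ratWindow, Set.mem_ofPred_eq] at h ⊢
    split_ifs with hx
    · have := lt_of_le_of_ne hx hne
      push_cast
      constructor <;> linarith
    · push_cast
      constructor <;> linarith⟩
  invFun x := ⟨if (x : ℝ) ≤ 2 * √2 / 3 then 3 * x else x / 2, by
    have h := x.2
    have hne := ratCast_ne_two_thirds_sqrt_two x
    simp only [ratWindow, Set.mem_ofPred_eq] at h ⊢
    split_ifs with hx
    · have := lt_of_le_of_ne hx hne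
      push_cast
      constructor <;> linarith
    · push_cast
      constructor <;> linarith⟩
  left_inv x := by
    have h := x.2
    simp only [ratWindow, Set.mem_ofPred_eq] at h
    ext
    by_cases hx : (x : ℝ) ≤ √2
    · have : ¬ (2 * (x : ℝ) ≤ 2 * √2 / 3) := by linarith
      simp [hx, this]
    · have : (x : ℝ) / 3 ≤ 2 * √2 / 3 := by linarith
      simp only [hx, if_false]
      push_cast
      rw [if_pos this]
      ring
  right_inv x := by
    have h := x.2
    simp only [ratWindow, Set.mem_ofPred_eq] at h
    ext
    by_cases hx : (x : ℝ) ≤ 2 * √2 / 3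
    · have : ¬ (3 * (x : ℝ) ≤ √2) := by linarith
      simp [hx, this]
    · have : (x : ℝ) / 2 ≤ √2 := by linarith
      simp only [hx, if_false]
      push_cast
      rw [if_pos this]
      ring
  continuous_toFun := by
    refine Continuous.subtype_mk (Continuous.if_le (by fun_prop) (by fun_prop)
      (Rat.continuous_coe_real.comp continuous_subtype_val) continuous_const ?_) _
    exact fun x hx => absurd hx (ratCast_ne_sqrt_two x)
  continuous_invFun := by
    refine Continuous.subtype_mk (Continuous.if_le (by fun_prop) (by fun_prop)
      (Rat.continuous_coe_real.comp continuous_subtype_val) continuous_const ?_) _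
    exact fun x hx => absurd hx (ratCast_ne_two_thirds_sqrt_two x)

lemma coe_windowExchange (x : ratWindow) :
    (windowExchange x : ℚ) = if (x : ℝ) ≤ √2 then 2 * (x : ℚ) else x / 3 := rfl

lemma windowExchange_iterate (x : ratWindow) (k : ℕ) :
    ∃ j : ℕ, ((windowExchange^[k] x : ratWindow) : ℚ) * 6 ^ j = 2 ^ k * x := by
  induction k with
  | zero => exact ⟨0, by simp⟩
  | succ k ih =>
    obtain ⟨j, hj⟩ := ih
    rw [Function.iterate_succ_apply', coe_windowExchange]
    split_ifs
    · exact ⟨j, by rw [pow_succ]; linear_combination 2 * hj⟩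
    · exact ⟨j + 1, by rw [pow_succ, pow_succ]; linear_combination 2 * hj⟩

lemma windowExchange_iterate_ne (x : ratWindow) {k : ℕ} (hk : 1 ≤ k) :
    windowExchange^[k] x ≠ x := by
  intro h
  obtain ⟨j, hj⟩ := windowExchange_iterate x k
  have hx : (x : ℚ) ≠ 0 := by
    have h1 := x.2.1
    intro h0
    rw [h0] at h1
    have := Real.sqrt_nonneg 2
    push_cast at h1
    linarith
  rw [h, mul_comm] at hj
  have hN : 6 ^ j = 2 ^ k := by exact_mod_cast mul_right_cancel₀ hx hj
  rcases Nat.eq_zero_or_pos j with rfl | hpos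
  · have := Nat.one_lt_two_pow (n := k) (by omega)
    simp at hN
    omega
  · have h3 : 3 ∣ 2 ^ k := hN ▸ (by norm_num : 3 ∣ 6).trans (dvd_pow_self 6 (by omega))
    have := Nat.prime_three.dvd_of_dvd_pow h3
    omega

lemma eq_of_mem_ratWindow {x y : ℚ} (hx : x ∈ ratWindow) (hy : y ∈ ratWindow) {j : ℤ}
    (h : x = y * 6 ^ j) : x = y := by
  obtain ⟨hx1, hx2⟩ := hx
  obtain ⟨hy1, hy2⟩ := hy
  have h2 : 0 < √2 := by positivity
  have hR : (x : ℝ) = y * 6 ^ j := by rw [h]; push_cast; rfl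
  have hy0 : (0 : ℝ) < y := by linarith
  rcases lt_trichotomy j 0 with hj | rfl | hj
  · have : (6 : ℝ) ^ j ≤ 6 ^ (-1 : ℤ) := zpow_le_zpow_right₀ (by norm_num) (by omega)
    norm_num at this
    nlinarith
  · simpa using h
  · have : (6 : ℝ) ^ (1 : ℤ) ≤ 6 ^ j := zpow_le_zpow_right₀ (by norm_num) (by omega)
    norm_num at this
    nlinarith

lemma exists_two_pow_mul_six_zpow_near_one {ε : ℝ} (hε : 0 < ε) :
    ∃ (k : ℕ) (j : ℤ), 1 ≤ k ∧ |(2 : ℝ) ^ k * 6 ^ j - 1| < ε := by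
  have h6 : 0 < Real.log 6 := Real.log_pos (by norm_num)
  obtain ⟨δ, hδ, hexp⟩ := Metric.continuousAt_iff.1 (Real.continuous_exp.continuousAt (x := 0)) ε hε
  obtain ⟨n, hn⟩ := exists_nat_one_div_lt (div_pos hδ h6)
  obtain ⟨j, k, hk, -, hjk⟩ :=
    Real.exists_int_int_abs_mul_sub_le (Real.log 2 / Real.log 6) (Nat.succ_pos n)
  lift k to ℕ using hk.le
  refine ⟨k, -j, by omega, ?_⟩
  have hlog : (2 : ℝ) ^ k * 6 ^ (-j) = Real.exp (k * Real.log 2 - j * Real.log 6) := by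
    rw [Real.exp_sub, ← Real.log_pow, ← Real.log_zpow, Real.exp_log (by positivity),
      Real.exp_log (by positivity), zpow_neg, div_eq_mul_inv]
  have hlt : |(k : ℝ) * (Real.log 2 / Real.log 6) - j| < δ / Real.log 6 := by
    refine lt_of_le_of_lt hjk (lt_of_le_of_lt ?_ hn)
    apply one_div_le_one_div_of_le <;> push_cast <;> linarith [Nat.cast_nonneg (α := ℝ) n]
  have hsmall : |(k : ℝ) * Real.log 2 - j * Real.log 6| < δ := by
    have heq : (k : ℝ) * Real.log 2 - j * Real.log 6
        = (k * (Real.log 2 / Real.log 6) - j) * Real.log 6 := by field_simp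
    rw [heq, abs_mul, abs_of_pos h6]
    exact (lt_div_iff₀ h6).1 hlt
  have := hexp (x := k * Real.log 2 - j * Real.log 6) (by simpa [Real.dist_eq] using hsmall)
  rw [hlog]
  simpa [Real.dist_eq] using this

/-- The point `1` is recurrent under `windowExchange`. -/
lemma windowExchange_recurrent {U : Set ratWindow} (hU : U ∈ nhds ⟨1, one_mem_ratWindow⟩) :
    ∃ k : ℕ, 1 ≤ k ∧ windowExchange^[k] ⟨1, one_mem_ratWindow⟩ ∈ U := by
  obtain ⟨ε, hε, hball⟩ := Metric.mem_nhds_iff.1 hU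
  obtain ⟨k, j, hk, hkj⟩ := exists_two_pow_mul_six_zpow_near_one
    (show 0 < min ε (1 / 4) by positivity)
  refine ⟨k, hk, hball ?_⟩
  have hmem : (2 : ℚ) ^ k * 6 ^ j ∈ ratWindow := by
    have h1 := Real.one_lt_sqrt_two
    have h2 := Real.sqrt_two_lt_three_halves
    have h3 := abs_lt.1 (hkj.trans_le (min_le_right _ _))
    constructor <;> push_cast <;> linarith
  obtain ⟨i, hi⟩ := windowExchange_iterate ⟨1, one_mem_ratWindow⟩ k
  have heq := eq_of_mem_ratWindow (windowExchange^[k] ⟨1, one_mem_ratWindow⟩).2 hmem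
    (j := -j - i) (by
      rw [mul_one] at hi
      rw [← hi, zpow_sub₀ (by norm_num), zpow_neg, zpow_natCast]
      field_simp)
  rw [Metric.mem_ball, Subtype.dist_eq, heq, Rat.dist_eq]
  push_cast
  exact hkj.trans_le (min_le_left _ _)

/-- A map of `ℚ` with a recurrent point is not conjugate to a nonzero translation. -/
lemma not_conj_translation_of_recurrent {f : ℚ → ℚ} {x : ℚ}
    (hrec : ∀ U ∈ nhds x, ∃ k : ℕ, 1 ≤ k ∧ f^[k] x ∈ U) (φ : ℚ ≃ₜ ℚ) {d : ℚ} (hd : d ≠ 0)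
    (hf : ∀ y, f (φ y) = φ (y + d)) : False := by
  have hit : ∀ (k : ℕ) (y : ℚ), f^[k] (φ y) = φ (y + k * d) := by
    intro k
    induction k with
    | zero => simp
    | succ k ih =>
      intro y
      rw [Function.iterate_succ_apply, hf, ih]
      push_cast
      ring_nf
  have hd' : (0 : ℝ) < |(d : ℝ)| := by simpa using hd
  obtain ⟨k, hk, hkU⟩ := hrec _ (φ.symm.continuous.continuousAt.preimage_mem_nhds
    (Metric.ball_mem_nhds (φ.symm x) hd'))
  have hx := hit k (φ.symm x)
  rw [φ.apply_symm_apply] at hx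
  rw [Set.mem_preimage, hx, φ.symm_apply_apply, Metric.mem_ball, Rat.dist_eq] at hkU
  push_cast at hkU
  rw [add_sub_cancel_left, abs_mul, Nat.abs_cast] at hkU
  have : (1 : ℝ) ≤ k := by exact_mod_cast hk
  nlinarith


/-- There is a periodic-point free homeomorphism of ℚ that is not a shift with
respect to any group operation on ℚ making it a topological group topologically isomorphic
to (ℚ, +). -/
theorem stmt_4 :
    ∃ f : ℚ ≃ₜ ℚ,
      (∀ (x : ℚ) (k : ℕ), 1 ≤ k → (⇑f)^[k] x ≠ x) ∧
      (∀ (op : ℚ → ℚ → ℚ) (e : ℚ) (inv : ℚ → ℚ),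
        (∀ a b c : ℚ, op (op a b) c = op a (op b c)) →
        (∀ a : ℚ, op e a = a) → (∀ a : ℚ, op a e = a) →
        (∀ a : ℚ, op (inv a) a = e) →
        Continuous (fun q : ℚ × ℚ => op q.1 q.2) →
        Continuous inv →
        (∃ φ : ℚ ≃ₜ ℚ, ∀ x y : ℚ, φ (x + y) = op (φ x) (φ y)) →
        ¬ ∃ c : ℚ, c ≠ e ∧ ∀ x : ℚ, f x = op x c) := by
  obtain ⟨e₀⟩ := Order.iso_of_countable_dense ratWindow ℚ
  let h : ratWindow ≃ₜ ℚ := e₀.toHomeomorph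
  let f : ℚ ≃ₜ ℚ := (h.symm.trans windowExchange).trans h
  have hit : ∀ (k : ℕ) (x : ratWindow), f^[k] (h x) = h (windowExchange^[k] x) := fun k x =>
    ((Function.Semiconj.iterate_right (f := h) (ga := windowExchange) (gb := f)
      (fun y => by simp [f]) k) x).symm
  refine ⟨f, fun x k hk hx => ?_, ?_⟩
  · obtain ⟨y, rfl⟩ := h.surjective x
    rw [hit] at hx
    exact windowExchange_iterate_ne y hk (h.injective hx)
  · rintro op e inv hassoc hel - hinv - - ⟨φ, hφ⟩ ⟨c, hc, hfc⟩
    refine not_conj_translation_of_recurrent (f := f) (x := h ⟨1, one_mem_ratWindow⟩) ?_ φ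
      (d := φ.symm c) ?_ (fun y => by rw [hfc, hφ, φ.apply_symm_apply])
    · intro U hU
      obtain ⟨k, hk, hkU⟩ :=
        windowExchange_recurrent (h.continuous.continuousAt.preimage_mem_nhds hU)
      exact ⟨k, hk, by rw [hit]; exact hkU⟩
    · intro h0
      have hφ0 : φ 0 = c := by rw [← h0, φ.apply_symm_apply]
      have hcc : op c c = c := by simpa [hφ0] using (hφ 0 0).symm
      exact hc (by rw [← hel c, ← hinv c, hassoc, hcc])
end

section
/- There exists a homeomorphism f : ℝ³ → ℝ³ (with the Euclidean topology) that is periodic-point free (for every v ∈ ℝ³ and every integer k ≥ 1, f^k(v) ≠ v) and such that for every binary operation ⊕ on ℝ³ for which (ℝ³, ⊕) with the Euclidean topology is a topological group admitting a map that is simultaneously a group isomorphism from (ℝ³, +) to (ℝ³, ⊕) and a homeomorphism, f is not a ⊕-shift (there is no non-neutral c with f(v) = v ⊕ c for all v). -/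
/-- The homeomorphism of ℝ³ that rotates by one radian about the third axis and moves each point
up by `(r ^ 2 - 1) ^ 2`, where `r` is its distance to that axis. -/
noncomputable def twistedLift : (Fin 3 → ℝ) ≃ₜ (Fin 3 → ℝ) where
  toFun v := ![Real.cos 1 * v 0 - Real.sin 1 * v 1, Real.sin 1 * v 0 + Real.cos 1 * v 1,
    v 2 + (v 0 ^ 2 + v 1 ^ 2 - 1) ^ 2]
  invFun v := ![Real.cos 1 * v 0 + Real.sin 1 * v 1, -Real.sin 1 * v 0 + Real.cos 1 * v 1,
    v 2 - (v 0 ^ 2 + v 1 ^ 2 - 1) ^ 2]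
  left_inv v := by
    have h := Real.sin_sq_add_cos_sq 1
    ext i
    fin_cases i <;> simp <;> grind
  right_inv v := by
    have h := Real.sin_sq_add_cos_sq 1
    ext i
    fin_cases i <;> simp <;> grind
  continuous_toFun := by
    refine continuous_pi fun i => ?_
    fin_cases i <;> simp <;> fun_prop
  continuous_invFun := by
    refine continuous_pi fun i => ?_
    fin_cases i <;> simp <;> fun_prop

lemma twistedLift_apply (v : Fin 3 → ℝ) :
    twistedLift v = ![Real.cos 1 * v 0 - Real.sin 1 * v 1, Real.sin 1 * v 0 + Real.cos 1 * v 1,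
      v 2 + (v 0 ^ 2 + v 1 ^ 2 - 1) ^ 2] := rfl

lemma twistedLift_iterate (k : ℕ) (v : Fin 3 → ℝ) :
    twistedLift^[k] v = ![Real.cos k * v 0 - Real.sin k * v 1,
      Real.sin k * v 0 + Real.cos k * v 1, v 2 + k * (v 0 ^ 2 + v 1 ^ 2 - 1) ^ 2] := by
  induction k with
  | zero =>
    ext i
    fin_cases i <;> simp
  | succ k ih =>
    have h := Real.sin_sq_add_cos_sq k
    rw [Function.iterate_succ_apply', ih, twistedLift_apply]
    push_cast
    rw [Real.cos_add, Real.sin_add]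
    ext i
    fin_cases i <;> simp <;> grind

lemma Real.cos_natCast_ne_one {k : ℕ} (hk : k ≠ 0) : Real.cos k ≠ 1 := by
  intro h
  obtain ⟨n, hn⟩ := (Real.cos_eq_one_iff _).1 h
  have hn0 : (n : ℝ) ≠ 0 := by
    rintro h0
    rw [h0, zero_mul] at hn
    exact hk (by exact_mod_cast hn.symm)
  refine irrational_pi ⟨k / (2 * n), ?_⟩
  push_cast
  rw [← hn]
  field_simp

lemma twistedLift_iterate_ne (v : Fin 3 → ℝ) {k : ℕ} (hk : k ≠ 0) : twistedLift^[k] v ≠ v := by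
  intro h
  rw [twistedLift_iterate] at h
  have h0 : Real.cos k * v 0 - Real.sin k * v 1 = v 0 := congrFun h 0
  have h1 : Real.sin k * v 0 + Real.cos k * v 1 = v 1 := congrFun h 1
  have h2 : v 2 + k * (v 0 ^ 2 + v 1 ^ 2 - 1) ^ 2 = v 2 := congrFun h 2
  have hr : v 0 ^ 2 + v 1 ^ 2 - 1 = 0 := by simpa [hk] using h2
  exact Real.cos_natCast_ne_one hk (by
    linear_combination v 0 * h0 + v 1 * h1 + (1 - Real.cos k) * hr)

lemma norm_twistedLift_iterate_le (k : ℕ) : ‖twistedLift^[k] ![1, 0, 0]‖ ≤ 1 := by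
  rw [twistedLift_iterate, pi_norm_le_iff_of_nonneg zero_le_one]
  intro i
  fin_cases i <;> simp [Real.abs_cos_le_one, Real.abs_sin_le_one]

/-- A map conjugate to a translation by a nonzero vector has only unbounded forward orbits. -/
lemma not_isBounded_orbit_of_conj_translation {E : Type*} [NormedAddCommGroup E] [NormedSpace ℝ E]
    [ProperSpace E] {f : E → E} {φ : E ≃ₜ E} {d : E} (hd : d ≠ 0)
    (hf : ∀ u, f (φ u) = φ (u + d)) (v : E) :
    ¬ Bornology.IsBounded (Set.range fun k : ℕ => f^[k] v) := by
  intro hb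
  have hiter (k : ℕ) : f^[k] v = φ (φ.symm v + k • d) := by
    induction k with
    | zero => simp
    | succ k ih => rw [Function.iterate_succ_apply', ih, hf, succ_nsmul, add_assoc]
  have hK : IsCompact (φ.symm '' closure (Set.range fun k : ℕ => f^[k] v)) :=
    hb.isCompact_closure.image φ.symm.continuous
  obtain ⟨C, hC⟩ := hK.isBounded.exists_norm_le
  obtain ⟨n, hn⟩ := exists_nat_gt ((C + ‖φ.symm v‖) / ‖d‖)
  have hmem := hC (φ.symm v + n • d)
    ⟨f^[n] v, subset_closure ⟨n, rfl⟩, by rw [hiter, φ.symm_apply_apply]⟩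
  have hle : ‖n • d‖ ≤ C + ‖φ.symm v‖ := by
    have := norm_sub_le (φ.symm v + n • d) (φ.symm v)
    rw [add_sub_cancel_left] at this
    linarith
  rw [div_lt_iff₀ (norm_pos_iff.2 hd)] at hn
  rw [← Nat.cast_smul_eq_nsmul ℝ, norm_smul, Real.norm_natCast] at hle
  linarith

/-- There is a periodic-point free homeomorphism of ℝ³ that is not a shift with
respect to any group operation on ℝ³ making it a topological group topologically isomorphic
to (ℝ³, +). -/
theorem stmt_5 :
    ∃ f : (Fin 3 → ℝ) ≃ₜ (Fin 3 → ℝ),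
      (∀ (v : Fin 3 → ℝ) (k : ℕ), 1 ≤ k → (⇑f)^[k] v ≠ v) ∧
      (∀ (op : (Fin 3 → ℝ) → (Fin 3 → ℝ) → (Fin 3 → ℝ)) (e : Fin 3 → ℝ)
        (inv : (Fin 3 → ℝ) → (Fin 3 → ℝ)),
        (∀ a b c, op (op a b) c = op a (op b c)) →
        (∀ a, op e a = a) → (∀ a, op a e = a) →
        (∀ a, op (inv a) a = e) →
        Continuous (fun q : (Fin 3 → ℝ) × (Fin 3 → ℝ) => op q.1 q.2) →
        Continuous inv →
        (∃ φ : (Fin 3 → ℝ) ≃ₜ (Fin 3 → ℝ), ∀ x y, φ (x + y) = op (φ x) (φ y)) →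
        ¬ ∃ c, c ≠ e ∧ ∀ v, f v = op v c) := by
  refine ⟨twistedLift, fun v k hk => twistedLift_iterate_ne v (Nat.one_le_iff_ne_zero.1 hk), ?_⟩
  rintro op e inv - - - - - - ⟨φ, hφ⟩ ⟨c, -, hc⟩
  have hconj (u : Fin 3 → ℝ) : twistedLift (φ u) = φ (u + φ.symm c) := by
    rw [hc, hφ, φ.apply_symm_apply]
  have hd : φ.symm c ≠ 0 := fun h =>
    twistedLift_iterate_ne (φ 0) one_ne_zero (by simp [hconj, h])
  refine not_isBounded_orbit_of_conj_translation hd hconj ![1, 0, 0] ?_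
  exact isBounded_iff_forall_norm_le.2
    ⟨1, Set.forall_mem_range.2 norm_twistedLift_iterate_le⟩
end

section
/- Let f : ℝ → ℝ be a continuous fixed-point free bijection (f(x) ≠ x for all x). Then f can be colored in three colors: there exist sets F₁, F₂, F₃ ⊆ ℝ with F₁ ∪ F₂ ∪ F₃ = ℝ such that f(F_i) ∩ F_i = ∅ for each i = 1, 2, 3. -/
/-- A permutation without finite cycles admits a set which it maps to its complement. -/
theorem Equiv.Perm.exists_set_apply_mem_iff_notMem {α : Type*} (e : Equiv.Perm α)
    (he : ∀ x, Function.Injective fun n : ℤ => (e ^ n) x) :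
    ∃ S : Set α, ∀ x, e x ∈ S ↔ x ∉ S := by
  let r : α → α := fun x => (Quotient.mk (Equiv.Perm.SameCycle.setoid e) x).out
  have hr : ∀ x, e.SameCycle (r x) x := fun x =>
    Quotient.mk_out (s := Equiv.Perm.SameCycle.setoid e) x
  have hr_apply : ∀ x, r (e x) = r x := fun x =>
    congrArg Quotient.out (Quotient.sound (s := Equiv.Perm.SameCycle.setoid e)
      (Equiv.Perm.sameCycle_apply_left.2 (Equiv.Perm.SameCycle.refl e x)))
  choose n hn using hr
  have hn_apply : ∀ x, n (e x) = n x + 1 := by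
    intro x
    apply he (r x)
    have h := hn (e x)
    rw [hr_apply] at h
    simp only [h, add_comm (n x) 1, zpow_add, zpow_one, Equiv.Perm.mul_apply, hn x]
  refine ⟨{x | Even (n x)}, fun x => ?_⟩
  simp only [Set.mem_ofPred_eq, hn_apply, Int.even_add_one]

/-- A continuous fixed-point free function on `ℝ` lies strictly on one side of the diagonal. -/
theorem Continuous.forall_lt_or_forall_gt_of_forall_ne {f : ℝ → ℝ} (hcont : Continuous f)
    (hfpf : ∀ x, f x ≠ x) : (∀ x, x < f x) ∨ ∀ x, f x < x := by
  by_contra! ⟨⟨a, ha⟩, b, hb⟩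
  obtain ⟨c, hc⟩ := mem_range_of_exists_le_of_exists_ge (hcont.sub continuous_id)
    ⟨a, sub_nonpos.2 ha⟩ ⟨b, sub_nonneg.2 hb⟩
  exact hfpf c (sub_eq_zero.1 hc)

/-- Every continuous fixed-point free bijection on ℝ can be colored in three
colors: there is a cover of ℝ by three sets, each disjoint from its image under f. -/
theorem stmt_9 (f : ℝ → ℝ) (hcont : Continuous f) (hbij : Function.Bijective f)
    (hfpf : ∀ x : ℝ, f x ≠ x) :
    ∃ F₁ F₂ F₃ : Set ℝ, F₁ ∪ F₂ ∪ F₃ = Set.univ ∧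
      (f '' F₁) ∩ F₁ = ∅ ∧ (f '' F₂) ∩ F₂ = ∅ ∧ (f '' F₃) ∩ F₃ = ∅ := by
  let e : Equiv.Perm ℝ := Equiv.ofBijective f hbij
  have hsucc : ∀ x (n : ℤ), (e ^ (n + 1)) x = f ((e ^ n) x) := by
    intro x n
    rw [add_comm, zpow_add, zpow_one, Equiv.Perm.mul_apply]
    rfl
  have he : ∀ x, Function.Injective fun n : ℤ => (e ^ n) x := by
    intro x
    rcases hcont.forall_lt_or_forall_gt_of_forall_ne hfpf with h | h
    · refine (strictMono_int_of_lt_succ fun n => ?_).injective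
      rw [hsucc]
      exact h _
    · refine (strictAnti_int_of_succ_lt fun n => ?_).injective
      rw [hsucc]
      exact h _
  obtain ⟨S, hS⟩ := e.exists_set_apply_mem_iff_notMem he
  refine ⟨S, Sᶜ, ∅, by simp, ?_, ?_, by simp⟩
  · rw [Set.eq_empty_iff_forall_notMem]
    rintro _ ⟨⟨x, hx, rfl⟩, hfx⟩
    exact (hS x).1 hfx hx
  · rw [Set.eq_empty_iff_forall_notMem]
    rintro _ ⟨⟨x, hx, rfl⟩, hfx⟩
    exact hfx ((hS x).2 hx)
end

section
/- Let α = √2 · π/180 (rotation by √2 degrees), let h : ℝ³ → ℝ³ be the rotation about the z-axis by angle α, i.e., h(x, y, z) = (x cos α − y sin α, x sin α + y cos α, z), let S = {(x, y, z) ∈ ℝ³ : x² + y² ≤ 1}, and let g : S → S be g(x, y, z) = (x, y, z + 1 − x² − y²). Define f : ℝ³ → ℝ³ by f(x, y, z) = h(x, y, z) if (x, y, z) ∉ S and f(x, y, z) = g(h(x, y, z)) if (x, y, z) ∈ S. Then f is a homeomorphism of ℝ³ and f is periodic-point free: for every v ∈ ℝ³ and every integer k ≥ 1, f^k(v) ≠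 v. -/
open Classical

/-- The rotation by `θ` about the z-axis followed by an upward slide of `c * (1 - x ^ 2 - y ^ 2)`
inside the unit solid cylinder. -/
noncomputable def screw (θ c : ℝ) (p : ℝ × ℝ × ℝ) : ℝ × ℝ × ℝ :=
  (p.1 * Real.cos θ - p.2.1 * Real.sin θ, p.1 * Real.sin θ + p.2.1 * Real.cos θ,
    p.2.2 + c * max 0 (1 - (p.1 ^ 2 + p.2.1 ^ 2)))

theorem continuous_screw (θ c : ℝ) : Continuous (screw θ c) := by
  unfold screw
  fun_prop

theorem rotation_sq_add_sq (θ x y : ℝ) :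
    (x * Real.cos θ - y * Real.sin θ) ^ 2 + (x * Real.sin θ + y * Real.cos θ) ^ 2
      = x ^ 2 + y ^ 2 := by
  linear_combination (x ^ 2 + y ^ 2) * Real.sin_sq_add_cos_sq θ

theorem screw_zero (p : ℝ × ℝ × ℝ) : screw 0 0 p = p := by
  simp [screw]

theorem screw_screw (θ c θ' c' : ℝ) (p : ℝ × ℝ × ℝ) :
    screw θ c (screw θ' c' p) = screw (θ + θ') (c + c') p := by
  simp only [screw, rotation_sq_add_sq, Real.cos_add, Real.sin_add, Prod.mk.injEq]
  refine ⟨?_, ?_, ?_⟩ <;> ring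

theorem iterate_screw (θ c : ℝ) (k : ℕ) (p : ℝ × ℝ × ℝ) :
    (screw θ c)^[k] p = screw (k * θ) (k * c) p := by
  induction k with
  | zero => simp [screw_zero]
  | succ k ih =>
    rw [Function.iterate_succ_apply', ih, screw_screw]
    push_cast
    congr 1 <;> ring

/-- A screw motion, as a homeomorphism. -/
noncomputable def screwHomeomorph (θ c : ℝ) : (ℝ × ℝ × ℝ) ≃ₜ (ℝ × ℝ × ℝ) where
  toFun := screw θ c
  invFun := screw (-θ) (-c)
  left_inv p := by rw [screw_screw, neg_add_cancel, neg_add_cancel, screw_zero]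
  right_inv p := by rw [screw_screw, add_neg_cancel, add_neg_cancel, screw_zero]
  continuous_toFun := continuous_screw θ c
  continuous_invFun := continuous_screw (-θ) (-c)

theorem cos_eq_one_of_screw_eq_self {θ c : ℝ} (hc : c ≠ 0) {p : ℝ × ℝ × ℝ}
    (hp : screw θ c p = p) : Real.cos θ = 1 := by
  obtain ⟨x, y, z⟩ := p
  simp only [screw, Prod.mk.injEq, add_eq_left, mul_eq_zero, hc, false_or] at hp
  obtain ⟨hx, hy, hz⟩ := hp
  have hr : 1 - (x ^ 2 + y ^ 2) ≤ 0 := max_eq_left_iff.mp hz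
  have hr' : x ^ 2 + y ^ 2 ≠ 0 := by linarith
  apply mul_left_cancel₀ hr'
  linear_combination x * hx + y * hy

theorem cos_nat_mul_sqrt_two_degrees_ne_one {k : ℕ} (hk : k ≠ 0) :
    Real.cos (k * (Real.sqrt 2 * Real.pi / 180)) ≠ 1 := by
  intro h
  obtain ⟨n, hn⟩ := (Real.cos_eq_one_iff _).mp h
  have hirr : Irrational (k * Real.sqrt 2) := irrational_sqrt_two.natCast_mul hk
  refine hirr.ne_int (360 * n) ?_
  apply mul_right_cancel₀ Real.pi_ne_zero
  push_cast
  linear_combination -180 * hn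

/-- The map f on ℝ³ that rotates by √2 degrees about the z-axis off the solid
cylinder S and additionally slides points of S up by 1 − x² − y² is a periodic-point free
homeomorphism. -/
theorem stmt_15 (α : ℝ) (hα : α = Real.sqrt 2 * Real.pi / 180)
    (h : ℝ × ℝ × ℝ → ℝ × ℝ × ℝ)
    (hh : ∀ p : ℝ × ℝ × ℝ, h p =
      (p.1 * Real.cos α - p.2.1 * Real.sin α, p.1 * Real.sin α + p.2.1 * Real.cos α, p.2.2))
    (S : Set (ℝ × ℝ × ℝ)) (hS : S = {p : ℝ × ℝ × ℝ | p.1 ^ 2 + p.2.1 ^ 2 ≤ 1})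
    (g : ℝ × ℝ × ℝ → ℝ × ℝ × ℝ)
    (hg : ∀ p : ℝ × ℝ × ℝ, g p = (p.1, p.2.1, p.2.2 + 1 - p.1 ^ 2 - p.2.1 ^ 2))
    (f : ℝ × ℝ × ℝ → ℝ × ℝ × ℝ)
    (hf : ∀ p : ℝ × ℝ × ℝ, f p = if p ∈ S then g (h p) else h p) :
    (∃ F : (ℝ × ℝ × ℝ) ≃ₜ (ℝ × ℝ × ℝ), ⇑F = f) ∧
      (∀ (v : ℝ × ℝ × ℝ) (k : ℕ), 1 ≤ k → f^[k] v ≠ v) := by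
  have hfs : f = screw α 1 := by
    funext p
    rw [hf]
    simp only [hS, hg, hh, Set.mem_ofPred_eq, screw]
    split_ifs with hp
    · rw [max_eq_right (by linarith)]
      simp only [Prod.mk.injEq, true_and]
      linear_combination -rotation_sq_add_sq α p.1 p.2.1
    · rw [max_eq_left (by linarith)]
      simp
  subst hfs
  refine ⟨⟨screwHomeomorph α 1, rfl⟩, fun v k hk hv => ?_⟩
  have hk' : k ≠ 0 := by lia
  rw [iterate_screw] at hv
  have hcos := cos_eq_one_of_screw_eq_self (by simpa using hk') hv
  rw [hα] at hcos
  exact cos_nat_mul_sqrt_two_degrees_ne_one hk' hcos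
end

section
/- Let α = √2 · π/180 and let f : ℝ³ → ℝ³ be defined as follows: with h the rotation about the z-axis by angle α, S = {(x, y, z) : x² + y² ≤ 1}, and g(x, y, z) = (x, y, z + 1 − x² − y²) on S, set f = h off S and f = g ∘ h on S. Then f^n(1, 0, 0) = (cos(nα), sin(nα), 0) for every n ∈ ℕ, the set {f^n(1, 0, 0) : n ∈ ℕ} is an infinite subset of the unit circle {(x, y, 0) : x² + y² = 1}, and this set has a cluster (accumulation) point in ℝ³. -/
open Classical

theorem injective_cos_sin_nat_mul {α : ℝ} (hα : Irrational (α / (2 * Real.pi))) :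
    Function.Injective fun n : ℕ ↦ (Real.cos (n * α), Real.sin (n * α)) := by
  intro n m hnm
  obtain ⟨hc, hs⟩ := Prod.mk.inj hnm
  obtain ⟨k, hk⟩ := Real.Angle.angle_eq_iff_two_pi_dvd_sub.1 (Real.Angle.cos_sin_inj hc hs)
  by_contra hne
  have hd : (n : ℝ) - m ≠ 0 := sub_ne_zero.2 (Nat.cast_injective.ne hne)
  refine hα ⟨(k : ℚ) / ((n : ℚ) - m), ?_⟩
  push_cast
  rw [div_eq_div_iff hd (by positivity)]
  linarith

theorem irrational_sqrt_two_degrees :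
    Irrational (Real.sqrt 2 * Real.pi / 180 / (2 * Real.pi)) := by
  have he : Real.sqrt 2 * Real.pi / 180 / (2 * Real.pi) = Real.sqrt 2 / (360 : ℕ) := by
    have := Real.pi_ne_zero
    push_cast
    field_simp
    norm_num
  rw [he]
  exact irrational_sqrt_two.div_natCast (by norm_num)

/-- For the map f of Example (rotation by √2 degrees about the z-axis,
with an extra vertical slide inside the cylinder S), the orbit of (1,0,0) consists of the
points (cos nα, sin nα, 0); it is an infinite subset of the unit circle in the xy-plane and
has a cluster point. -/
theorem stmt_16 (α : ℝ) (hα : α = Real.sqrt 2 * Real.pi / 180)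
    (h : ℝ × ℝ × ℝ → ℝ × ℝ × ℝ)
    (hh : ∀ p : ℝ × ℝ × ℝ, h p =
      (p.1 * Real.cos α - p.2.1 * Real.sin α, p.1 * Real.sin α + p.2.1 * Real.cos α, p.2.2))
    (S : Set (ℝ × ℝ × ℝ)) (hS : S = {p : ℝ × ℝ × ℝ | p.1 ^ 2 + p.2.1 ^ 2 ≤ 1})
    (g : ℝ × ℝ × ℝ → ℝ × ℝ × ℝ)
    (hg : ∀ p : ℝ × ℝ × ℝ, g p = (p.1, p.2.1, p.2.2 + 1 - p.1 ^ 2 - p.2.1 ^ 2))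
    (f : ℝ × ℝ × ℝ → ℝ × ℝ × ℝ)
    (hf : ∀ p : ℝ × ℝ × ℝ, f p = if p ∈ S then g (h p) else h p) :
    (∀ n : ℕ, f^[n] ((1 : ℝ), (0 : ℝ), (0 : ℝ)) =
      (Real.cos (n * α), Real.sin (n * α), 0)) ∧
    Set.Infinite {q : ℝ × ℝ × ℝ | ∃ n : ℕ, q = f^[n] ((1 : ℝ), (0 : ℝ), (0 : ℝ))} ∧
    {q : ℝ × ℝ × ℝ | ∃ n : ℕ, q = f^[n] ((1 : ℝ), (0 : ℝ), (0 : ℝ))} ⊆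
      {q : ℝ × ℝ × ℝ | q.1 ^ 2 + q.2.1 ^ 2 = 1 ∧ q.2.2 = 0} ∧
    ∃ p : ℝ × ℝ × ℝ,
      AccPt p (Filter.principal
        {q : ℝ × ℝ × ℝ | ∃ n : ℕ, q = f^[n] ((1 : ℝ), (0 : ℝ), (0 : ℝ))}) := by
  have orbit (n : ℕ) : f^[n] ((1 : ℝ), (0 : ℝ), (0 : ℝ)) =
      (Real.cos (n * α), Real.sin (n * α), 0) := by
    induction n with
    | zero => simp
    | succ n ih =>
      have hrot : h (Real.cos (n * α), Real.sin (n * α), 0) =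
          (Real.cos ((n + 1 : ℕ) * α), Real.sin ((n + 1 : ℕ) * α), 0) := by
        rw [hh, Nat.cast_succ, add_one_mul, Real.cos_add, Real.sin_add,
          add_comm (Real.sin _ * _)]
      have hmem : (Real.cos (n * α), Real.sin (n * α), (0 : ℝ)) ∈ S := by
        rw [hS]
        exact (Real.cos_sq_add_sin_sq _).le
      rw [Function.iterate_succ_apply', ih, hf, if_pos hmem, hrot, hg]
      refine Prod.ext rfl (Prod.ext rfl ?_)
      change 0 + 1 - Real.cos _ ^ 2 - Real.sin _ ^ 2 = 0
      linarith [Real.cos_sq_add_sin_sq ((n + 1 : ℕ) * α)]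
  have hinj : Function.Injective fun n : ℕ ↦ f^[n] ((1 : ℝ), (0 : ℝ), (0 : ℝ)) := by
    intro n m hnm
    simp only [orbit, Prod.mk.injEq, and_true] at hnm
    exact injective_cos_sin_nat_mul (hα ▸ irrational_sqrt_two_degrees)
      (Prod.ext hnm.1 hnm.2)
  have hinf : Set.Infinite
      {q : ℝ × ℝ × ℝ | ∃ n : ℕ, q = f^[n] ((1 : ℝ), (0 : ℝ), (0 : ℝ))} :=
    (Set.infinite_range_of_injective hinj).mono (by
      rintro _ ⟨n, rfl⟩
      exact ⟨n, rfl⟩)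
  refine ⟨orbit, hinf, ?_, ?_⟩
  · rintro _ ⟨n, rfl⟩
    rw [orbit]
    exact ⟨Real.cos_sq_add_sin_sq _, rfl⟩
  · have hK : IsCompact (Set.Icc (-1 : ℝ) 1 ×ˢ Set.Icc (-1 : ℝ) 1 ×ˢ {(0 : ℝ)}) :=
      isCompact_Icc.prod (isCompact_Icc.prod isCompact_singleton)
    obtain ⟨p, -, hp⟩ := hinf.exists_accPt_of_subset_isCompact hK (by
      rintro _ ⟨n, rfl⟩
      rw [orbit]
      exact ⟨Real.cos_mem_Icc _, Real.sin_mem_Icc _, rfl⟩)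
    exact ⟨p, hp⟩
end
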